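/- The set of quotients π₁/π₂ of Gaussian primes π₁, π₂ ∈ ℤ[i] is dense in the complex plane ℂ. -/

import Mathlib

open MeasureTheory Filter Topology

noncomputable def gpV (t : ℝ) : ℝ := (3 * (Real.pi - t) * Real.cos t + 5 * Real.sin t) / 2

noncomputable def gpW (t : ℝ) : ℝ := gpV (min |t| Real.pi)

lemma gpV_cont : Continuous gpV := by unfold gpV; fun_prop

lemma gpW_cont : Continuous gpW := by
  unfold gpW
  exact gpV_cont.comp (by fun_prop)

lemma gpW_zero_of {t : ℝ} (h : Real.pi ≤ |t|) : gpW t = 0 := by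
  unfold gpW; rw [min_eq_right h]; simp [gpV]

lemma gpW_neg (t : ℝ) : gpW (-t) = gpW t := by simp [gpW]

lemma gpW_supp : HasCompactSupport (fun t => (gpW t : ℂ)) := by
  apply HasCompactSupport.intro (K := Set.Icc (-Real.pi) Real.pi) isCompact_Icc
  intro t ht
  rw [gpW_zero_of]; · simp
  by_contra h
  exact ht (abs_le.mp (not_le.mp h).le)

noncomputable def gpF (w : ℝ → ℂ) (u : ℝ) : ℂ := ∫ t, w t * Complex.exp (Complex.I * t * u)

lemma gpF_W (u : ℝ) :
    gpF (fun t => (gpW t : ℂ)) u = ((2 * ∫ t in (0:ℝ)..Real.pi, gpV t * Real.cos (t * u) : ℝ) : ℂ) := by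
  unfold gpF
  have hc : Continuous (fun t : ℝ => (gpW t : ℂ) * Complex.exp (Complex.I * t * u)) := by
    have := gpW_cont
    fun_prop
  rw [← intervalIntegral.integral_eq_integral_of_support_subset (a := -Real.pi) (b := Real.pi)]
  · rw [← intervalIntegral.integral_add_adjacent_intervals (b := 0) (hc.intervalIntegrable _ _) (hc.intervalIntegrable _ _)]
    have h1 := intervalIntegral.integral_comp_neg (a := 0) (b := Real.pi)
      (fun t : ℝ => (gpW t : ℂ) * Complex.exp (Complex.I * t * u))
    rw [neg_zero] at h1
    rw [← h1, ← intervalIntegral.integral_add]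
    · rw [Complex.ofReal_mul, ← intervalIntegral.integral_ofReal, ← intervalIntegral.integral_const_mul]
      apply intervalIntegral.integral_congr
      intro t ht
      rw [Set.uIcc_of_le Real.pi_pos.le] at ht
      have h2 : gpW t = gpV t := by
        unfold gpW; rw [abs_of_nonneg ht.1, min_eq_left ht.2]
      simp only [gpW_neg, h2]
      push_cast
      rw [Complex.cos]
      have e1 : Complex.I * -(t:ℂ) * u = -((t:ℂ) * u) * Complex.I := by ring
      have e2 : Complex.I * (t:ℂ) * u = ((t:ℂ) * u) * Complex.I := by ring
      rw [e1, e2]; ring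
    · apply Continuous.intervalIntegrable
      exact hc.comp continuous_neg
    · exact hc.intervalIntegrable _ _
  · intro t ht
    rw [Function.mem_support] at ht
    by_contra h
    apply ht
    beta_reduce
    rw [gpW_zero_of]; · simp
    by_contra h3
    obtain ⟨h4, h5⟩ := abs_lt.mp (not_le.mp h3)
    exact h ⟨h4, h5.le⟩

lemma gp_closed (u : ℝ) (hu : 1 - u ^ 2 ≠ 0) :
    ∫ t in (0:ℝ)..Real.pi, gpV t * Real.cos (t * u)
      = (1 + Real.cos (Real.pi * u)) * (4 - u ^ 2) / (1 - u ^ 2) ^ 2 := by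
  set A : ℝ := -(3 / 2) * u / (1 - u ^ 2) with hA
  set C : ℝ := (3 / 2) / (1 - u ^ 2) with hC
  set D : ℝ := -(4 - u ^ 2) / (1 - u ^ 2) ^ 2 with hD
  set B : ℝ := A + u * D with hB
  have i1 : A + u * C = 0 := by rw [hA, hC]; field_simp; ring
  have i2 : u * A + C = 3 / 2 := by rw [hA, hC]; field_simp; ring
  have i3 : u * B - C - D = 5 / 2 := by rw [hB, hA, hC, hD]; field_simp; ring
  rw [intervalIntegral.integral_eq_sub_of_hasDerivAt (f := fun t =>
    (A * (Real.pi - t) * Real.cos t + B * Real.sin t) * Real.sin (t * u) +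
    (C * (Real.pi - t) * Real.sin t + D * Real.cos t) * Real.cos (t * u))]
  · simp
    rw [hD]; field_simp; ring
  · intro t _
    have hs : HasDerivAt (fun t => Real.sin (t * u)) (Real.cos (t * u) * (1 * u)) t :=
      ((hasDerivAt_id t).mul_const u).sin
    have hc : HasDerivAt (fun t => Real.cos (t * u)) (-Real.sin (t * u) * (1 * u)) t :=
      ((hasDerivAt_id t).mul_const u).cos
    have hl : HasDerivAt (fun t => Real.pi - t) (-1) t := by
      simpa using (hasDerivAt_id t).const_sub Real.pi
    have h := ((((hl.const_mul A).mul (Real.hasDerivAt_cos t)).add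
      ((Real.hasDerivAt_sin t).const_mul B)).mul hs).add
      ((((hl.const_mul C).mul (Real.hasDerivAt_sin t)).add
      ((Real.hasDerivAt_cos t).const_mul D)).mul hc)
    refine (h.congr_deriv ?_)
    simp only [gpV]
    simp only [Pi.add_apply, Pi.mul_apply]
    have i4 : B = A + u * D := rfl
    clear_value B D C A
    linear_combination (-(Real.pi - t) * Real.sin t * Real.sin (t * u)) * i1 +
      (Real.pi - t) * Real.cos t * Real.cos (t * u) * i2 + Real.sin t * Real.cos (t * u) * i3
      + Real.cos t * Real.sin (t * u) * i4
  · apply Continuous.intervalIntegrable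
    have := gpV_cont
    fun_prop

lemma gpF_cont {w : ℝ → ℂ} (hw : Continuous w) (hs : HasCompactSupport w) : Continuous (gpF w) := by
  unfold gpF
  apply continuous_of_dominated (bound := fun t => ‖w t‖)
  · intro u
    exact (by fun_prop : Continuous _).aestronglyMeasurable
  · intro u
    refine Eventually.of_forall fun t => ?_
    rw [norm_mul]
    have : Complex.I * t * u = ((t * u : ℝ) : ℂ) * Complex.I := by push_cast; ring
    rw [this, Complex.norm_exp_ofReal_mul_I, mul_one]
  · exact (hw.integrable_of_hasCompactSupport hs).norm
  · refine Eventually.of_forall fun t => ?_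
    fun_prop

lemma gpF_bound {w : ℝ → ℂ} (u : ℝ) : ‖gpF w u‖ ≤ ∫ t, ‖w t‖ := by
  unfold gpF
  refine (norm_integral_le_integral_norm _).trans (le_of_eq ?_)
  congr 1; ext t
  rw [norm_mul]
  have : Complex.I * t * u = ((t * u : ℝ) : ℂ) * Complex.I := by push_cast; ring
  rw [this, Complex.norm_exp_ofReal_mul_I, mul_one]

lemma gpF_W_of {u : ℝ} (hu : 2 ≤ |u|) : gpF (fun t => (gpW t : ℂ)) u
    = ((2 * ((1 + Real.cos (Real.pi * u)) * (4 - u ^ 2) / (1 - u ^ 2) ^ 2) : ℝ) : ℂ) := by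
  have h4 : 4 ≤ u ^ 2 := by rw [← sq_abs]; nlinarith
  rw [gpF_W, gp_closed u (by nlinarith)]

lemma gpF_W_integrable : Integrable (gpF (fun t => (gpW t : ℂ))) := by
  have hw : Continuous (fun t => (gpW t : ℂ)) := by have := gpW_cont; fun_prop
  set M := ∫ t, ‖(gpW t : ℂ)‖
  have hM : 0 ≤ M := integral_nonneg fun _ => norm_nonneg _
  refine Integrable.mono' ((integrable_inv_one_add_sq).const_mul (5 * M + 8))
    (gpF_cont hw gpW_supp).aestronglyMeasurable (Eventually.of_forall fun u => ?_)
  have hp : 0 < 1 + u ^ 2 := by positivity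
  rw [← div_eq_mul_inv, le_div_iff₀ hp]
  rcases le_or_gt 2 |u| with h | h
  · have h4 : 4 ≤ u ^ 2 := by rw [← sq_abs]; nlinarith
    rw [gpF_W_of h, Complex.norm_real, Real.norm_eq_abs, abs_mul, abs_div, abs_mul]
    have c1 := Real.neg_one_le_cos (Real.pi * u)
    have c2 := Real.cos_le_one (Real.pi * u)
    rw [abs_of_nonneg (by norm_num : (0:ℝ) ≤ 2), abs_of_nonneg (by linarith : 0 ≤ 1 + Real.cos (Real.pi * u)),
      abs_of_nonpos (by linarith : 4 - u ^ 2 ≤ 0), abs_of_nonneg (by positivity : 0 ≤ (1 - u ^ 2) ^ 2)]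
    have h5 : (1 + Real.cos (Real.pi * u)) * -(4 - u ^ 2) / (1 - u ^ 2) ^ 2 ≤ 2 * (u ^ 2 - 1) / (1 - u ^ 2) ^ 2 := by
      gcongr <;> nlinarith
    have h6 : 2 * (u ^ 2 - 1) / (1 - u ^ 2) ^ 2 = 2 / (u ^ 2 - 1) := by
      have : u ^ 2 - 1 ≠ 0 := by nlinarith
      have : 1 - u ^ 2 ≠ 0 := by nlinarith
      field_simp; ring
    have h7 : 2 / (u ^ 2 - 1) * (1 + u ^ 2) ≤ 4 := by
      rw [div_mul_eq_mul_div, div_le_iff₀ (by linarith)]; linarith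
    rw [h6] at h5
    nlinarith
  · have h4 : u ^ 2 ≤ 4 := by rw [← sq_abs]; nlinarith [abs_nonneg u]
    have := gpF_bound (w := fun t => (gpW t : ℂ)) u
    nlinarith [norm_nonneg (gpF (fun t => (gpW t : ℂ)) u)]

lemma gpF_W_int : ∫ u, gpF (fun t => (gpW t : ℂ)) u = 3 * Real.pi ^ 2 := by
  have hw : Continuous (fun t => (gpW t : ℂ)) := by have := gpW_cont; fun_prop
  have e : FourierTransform.fourier (fun t : ℝ => (gpW t : ℂ)) = fun ξ : ℝ => gpF (fun t => (gpW t : ℂ)) (-(2 * Real.pi) * ξ) := by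
    ext ξ
    rw [Real.fourier_real_eq_integral_exp_smul]
    unfold gpF
    congr 1; ext t
    rw [smul_eq_mul, mul_comm]
    congr 2
    push_cast; ring
  have hi : Integrable (FourierTransform.fourier (fun t : ℝ => (gpW t : ℂ))) := by
    rw [e]
    exact gpF_W_integrable.comp_mul_left' (by simp [Real.pi_ne_zero])
  have h := congrFun (hw.fourierInv_fourier_eq (hw.integrable_of_hasCompactSupport gpW_supp) hi) 0
  rw [Real.fourierInv_eq', e] at h
  simp only [inner_zero_right, mul_zero, Complex.ofReal_zero, zero_mul, Complex.exp_zero, one_smul] at h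
  rw [Measure.integral_comp_mul_left (g := gpF (fun t => (gpW t : ℂ)))] at h
  have hp := Real.pi_pos
  have h2 : gpW 0 = 3 * Real.pi / 2 := by simp [gpW, gpV, hp.le]
  rw [h2, abs_inv, abs_neg, abs_of_pos (by positivity)] at h
  rw [Complex.real_smul] at h
  push_cast at h
  have : (Real.pi : ℂ) ≠ 0 := by exact_mod_cast hp.ne'
  field_simp at h
  rw [h]; ring

lemma gp_kernel (η : ℝ) (hη : 0 < η) : ∃ w : ℝ → ℂ, Continuous w ∧ HasCompactSupport w ∧
    Integrable (gpF w) ∧ (∀ u, η ≤ |u| → (gpF w u).re ≤ 0) ∧ 0 < (∫ u, gpF w u).re := by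
  have hw : Continuous (fun t => (gpW t : ℂ)) := by have := gpW_cont; fun_prop
  set l := 2 / η with hl
  have lp : 0 < l := by positivity
  have e : ∀ u, gpF (fun t => (l⁻¹ : ℂ) * (gpW (l⁻¹ * t) : ℂ)) u = gpF (fun t => (gpW t : ℂ)) (l * u) := by
    intro u
    have h := Measure.integral_comp_mul_left (fun t : ℝ => (gpW t : ℂ) * Complex.exp (Complex.I * t * (l * u : ℝ))) l⁻¹
    rw [inv_inv, abs_of_pos lp] at h
    have h2 : gpF (fun t => (gpW t : ℂ)) (l * u) = (l⁻¹ : ℝ) • (l • ∫ (y : ℝ), (gpW y : ℂ) * Complex.exp (Complex.I * y * (l * u : ℝ))) := by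
      rw [smul_smul, inv_mul_cancel₀ lp.ne', one_smul]; rfl
    rw [h2, ← h, ← integral_smul]
    unfold gpF
    congr 1; ext t
    rw [Complex.real_smul, mul_assoc]
    push_cast
    congr 3
    have : (l : ℂ) ≠ 0 := by exact_mod_cast lp.ne'
    field_simp
  refine ⟨fun t => (l⁻¹ : ℂ) * (gpW (l⁻¹ * t) : ℂ), by have := gpW_cont; fun_prop, ?_, ?_, ?_, ?_⟩
  · apply HasCompactSupport.mul_left
    exact gpW_supp.comp_homeomorph (Homeomorph.mulLeft₀ l⁻¹ (by positivity))
  · rw [funext e]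
    exact gpF_W_integrable.comp_mul_left' lp.ne'
  · intro u hu
    have h2 : 2 ≤ |l * u| := by
      rw [abs_mul, abs_of_pos lp, hl, div_mul_eq_mul_div, le_div_iff₀ hη]; nlinarith
    rw [e, gpF_W_of h2, Complex.ofReal_re]
    have h4 : 4 ≤ (l * u) ^ 2 := by rw [← sq_abs]; nlinarith
    have c1 := Real.neg_one_le_cos (Real.pi * (l * u))
    have : (1 + Real.cos (Real.pi * (l * u))) * (4 - (l * u) ^ 2) / (1 - (l * u) ^ 2) ^ 2 ≤ 0 :=
      div_nonpos_of_nonpos_of_nonneg (mul_nonpos_of_nonneg_of_nonpos (by linarith) (by linarith)) (by positivity)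
    linarith
  · rw [funext e, Measure.integral_comp_mul_left, gpF_W_int, abs_of_pos (by positivity)]
    rw [Complex.real_smul]
    have : ((l⁻¹ : ℝ) : ℂ) * (3 * (Real.pi : ℂ) ^ 2) = ((l⁻¹ * (3 * Real.pi ^ 2) : ℝ) : ℂ) := by push_cast; ring
    rw [this, Complex.ofReal_re]
    have := Real.pi_pos
    positivity

lemma gp_norm_exp (t u : ℝ) : ‖Complex.exp (Complex.I * t * u)‖ = 1 := by
  have : Complex.I * t * u = ((t * u : ℝ) : ℂ) * Complex.I := by push_cast; ring
  rw [this, Complex.norm_exp_ofReal_mul_I]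

/-- exchange of sum and integral -/
lemma gp_sum_side {w : ℝ → ℂ} (hw : Continuous w) (hs : HasCompactSupport w) (b : ℕ → ℝ)
    (σ x : ℝ) (hb : LSeriesSummable (fun n => (b n : ℂ)) (1 + σ : ℝ)) :
    HasSum (fun n : ℕ => LSeries.term (fun n => (b n : ℂ)) (1 + σ : ℝ) n * gpF w (x - Real.log n))
      (∫ t : ℝ, w t * Complex.exp (Complex.I * t * x) *
        LSeries (fun n => (b n : ℂ)) (1 + σ + Complex.I * t)) := by
  have key : ∀ (n : ℕ) (t : ℝ), w t * Complex.exp (Complex.I * t * x) *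
      LSeries.term (fun n => (b n : ℂ)) (1 + σ + Complex.I * t) n =
      LSeries.term (fun n => (b n : ℂ)) (1 + σ : ℝ) n * (w t * Complex.exp (Complex.I * t * (x - Real.log n : ℝ))) := by
    intro n t
    rcases eq_or_ne n 0 with rfl | hn
    · simp
    · rw [LSeries.term_of_ne_zero hn, LSeries.term_of_ne_zero hn]
      have hn' : (n : ℂ) ≠ 0 := by exact_mod_cast hn
      rw [Complex.cpow_def_of_ne_zero hn', Complex.cpow_def_of_ne_zero hn', Complex.natCast_log.symm]
      rw [div_eq_mul_inv, div_eq_mul_inv, ← Complex.exp_neg, ← Complex.exp_neg]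
      have : Complex.exp (Complex.I * t * x) * Complex.exp (-(Real.log n * (1 + σ + Complex.I * t)))
        = Complex.exp (-(Real.log n * (1 + σ : ℝ))) * Complex.exp (Complex.I * t * (x - Real.log n : ℝ)) := by
        rw [← Complex.exp_add, ← Complex.exp_add]
        congr 1; push_cast; ring
      linear_combination w t * b n * this
  have hi : ∀ y : ℝ, Integrable (fun t : ℝ => w t * Complex.exp (Complex.I * t * y)) := by
    intro y
    exact (by fun_prop : Continuous _).integrable_of_hasCompactSupport hs.mul_right
  have := hasSum_integral_of_summable_integral_norm (μ := (volume : Measure ℝ)) (F := fun (n : ℕ) (t : ℝ) => w t * Complex.exp (Complex.I * t * x) *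
      LSeries.term (fun n => (b n : ℂ)) (1 + σ + Complex.I * t) n) ?_ ?_
  · have e1 : (fun n : ℕ => LSeries.term (fun n => (b n : ℂ)) (1 + σ : ℝ) n * gpF w (x - Real.log n)) =
        fun n : ℕ => ∫ t : ℝ, w t * Complex.exp (Complex.I * t * x) *
      LSeries.term (fun n => (b n : ℂ)) (1 + σ + Complex.I * t) n := by
      ext n
      simp_rw [key]
      rw [integral_const_mul]
      rfl
    have e2 : (∫ t : ℝ, w t * Complex.exp (Complex.I * t * x) *
        LSeries (fun n => (b n : ℂ)) (1 + σ + Complex.I * t)) = ∫ t : ℝ, ∑' n : ℕ, w t * Complex.exp (Complex.I * t * x) *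
      LSeries.term (fun n => (b n : ℂ)) (1 + σ + Complex.I * t) n := by
      congr 1; ext t
      rw [tsum_mul_left]; rfl
    rw [e1, e2]; exact this
  · intro n
    simp_rw [key]
    exact (hi _).const_mul _
  · simp_rw [key, norm_mul, gp_norm_exp, mul_one]
    simp_rw [integral_const_mul]
    exact (hb.norm).mul_right _

lemma gp_pole_side {w : ℝ → ℂ} (hw : Continuous w) (hs : HasCompactSupport w) (σ x : ℝ) (hσ : 0 < σ) :
    ∫ t : ℝ, w t * Complex.exp (Complex.I * t * x) * (1 / (σ + Complex.I * t)) =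
      ∫ u in Set.Ioi (0:ℝ), Complex.exp (-σ * u) * gpF w (x - u) := by
  have h1 : ∀ t : ℝ, w t * Complex.exp (Complex.I * t * x) * (1 / (σ + Complex.I * t)) =
      ∫ u in Set.Ioi (0:ℝ), Complex.exp (-σ * u) * (w t * Complex.exp (Complex.I * t * (x - u : ℝ))) := by
    intro t
    have := integral_exp_mul_complex_Ioi (a := -(σ + Complex.I * t)) (by simp [hσ]) 0
    have e : (1 / (σ + Complex.I * t)) = ∫ u in Set.Ioi (0:ℝ), Complex.exp (-(σ + Complex.I * t) * u) := by
      rw [this, Complex.ofReal_zero, mul_zero, Complex.exp_zero, neg_div_neg_eq]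
    rw [e, ← integral_const_mul]
    congr 1; ext u
    have : Complex.exp (Complex.I * t * x) * Complex.exp (-(σ + Complex.I * t) * u) =
      Complex.exp (-σ * u) * Complex.exp (Complex.I * t * (x - u : ℝ)) := by
      rw [← Complex.exp_add, ← Complex.exp_add]
      congr 1; push_cast; ring
    linear_combination w t * this
  simp_rw [h1]
  rw [integral_integral_swap]
  · congr 1; ext u
    rw [integral_const_mul]; rfl
  · have hwi := hw.integrable_of_hasCompactSupport hs (μ := volume)
    have he : IntegrableOn (fun u : ℝ => Complex.exp (-σ * u)) (Set.Ioi 0) := by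
      exact integrableOn_exp_mul_complex_Ioi (by simpa using hσ) 0
    have hp := hwi.mul_prod he.integrable
    refine hp.norm.mono' ?_ (Eventually.of_forall fun p => ?_)
    · apply Continuous.aestronglyMeasurable
      unfold Function.uncurry
      fun_prop
    · simp only [Function.uncurry, norm_mul, gp_norm_exp]
      rw [mul_one, mul_comm]

lemma gp_tauber (b : ℕ → ℝ) (hb0 : ∀ n, 0 ≤ b n) (G : ℂ → ℂ) (c : ℝ) (hc : 0 < c)
    (hG : ContinuousOn G {s | 1 ≤ s.re})
    (hsum : ∀ s : ℂ, 1 < s.re → LSeriesSummable (fun n => (b n : ℂ)) s)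
    (hA : ∀ s : ℂ, 1 < s.re → LSeries (fun n => (b n : ℂ)) s = c * (1 / (s - 1)) + G s)
    (η : ℝ) (hη : 0 < η) :
    ∀ᶠ x : ℝ in atTop, ∃ n : ℕ, b n ≠ 0 ∧ |x - Real.log n| < η := by
  obtain ⟨w, hw, hs, hF, hneg, hpos⟩ := gp_kernel η hη
  have hwi := hw.integrable_of_hasCompactSupport hs (μ := volume)
  -- reduced statement
  have hGc : ∀ σ : ℝ, 0 ≤ σ → Continuous (fun t : ℝ => G (1 + σ + Complex.I * t)) := by
    intro σ hσ
    exact hG.comp_continuous (by fun_prop) (by intro t; simp [hσ])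
  have main : ∀ x : ℝ, (∀ n : ℕ, b n ≠ 0 → η ≤ |x - Real.log n|) →
      (c * (∫ u in Set.Ioi (0:ℝ), gpF w (x - u)) +
       ∫ t : ℝ, w t * Complex.exp (Complex.I * t * x) * G (1 + Complex.I * t)).re ≤ 0 := by
    intro x hx
    have step : ∀ σ : ℝ, 0 < σ → (c * (∫ u in Set.Ioi (0:ℝ), Complex.exp (-σ * u) * gpF w (x - u)) +
       ∫ t : ℝ, w t * Complex.exp (Complex.I * t * x) * G (1 + σ + Complex.I * t)).re ≤ 0 := by
      intro σ hσ
      have h1 := gp_sum_side hw hs b σ x (hsum _ (by simp [hσ]))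
      have h2 : (∫ t : ℝ, w t * Complex.exp (Complex.I * t * x) *
        LSeries (fun n => (b n : ℂ)) (1 + σ + Complex.I * t)) =
          (c * (∫ u in Set.Ioi (0:ℝ), Complex.exp (-σ * u) * gpF w (x - u)) +
       ∫ t : ℝ, w t * Complex.exp (Complex.I * t * x) * G (1 + σ + Complex.I * t)) := by
        rw [← gp_pole_side hw hs σ x hσ, ← integral_const_mul, ← integral_add]
        · congr 1; ext t
          rw [hA _ (by simp [hσ])]
          have : (1 + σ + Complex.I * t - 1 : ℂ) = σ + Complex.I * t := by ring
          rw [this]; ring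
        · apply Integrable.const_mul
          apply Continuous.integrable_of_hasCompactSupport _ (hs.mul_right.mul_right)
          have : ∀ t : ℝ, (σ + Complex.I * t : ℂ) ≠ 0 := by
            intro t h
            have := congrArg Complex.re h
            simp at this; linarith
          fun_prop (disch := exact this _)
        · have := hGc σ hσ.le
          exact ((by fun_prop : Continuous (fun t : ℝ => w t * Complex.exp (Complex.I * t * x))).mul this).integrable_of_hasCompactSupport (hs.mul_right.mul_right)
      rw [h2] at h1
      refine (Complex.hasSum_re h1).nonpos fun n => ?_
      rcases eq_or_ne n 0 with rfl | hn
      · simp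
      by_cases hbn : b n = 0
      · simp [LSeries.term_of_ne_zero hn, hbn]
      · rw [LSeries.term_of_ne_zero hn]
        have : ((n : ℂ) ^ ((1 + σ : ℝ) : ℂ)) = (((n : ℝ) ^ (1 + σ) : ℝ) : ℂ) := by
          rw [Complex.ofReal_cpow (by positivity)]; simp
        rw [this, ← Complex.ofReal_div, Complex.re_ofReal_mul]
        exact mul_nonpos_of_nonneg_of_nonpos (div_nonneg (hb0 n) (by positivity)) (hneg _ (hx n hbn))
    have lim : Tendsto (fun σ : ℝ => (c * (∫ u in Set.Ioi (0:ℝ), Complex.exp (-σ * u) * gpF w (x - u)) +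
       ∫ t : ℝ, w t * Complex.exp (Complex.I * t * x) * G (1 + σ + Complex.I * t)).re) (𝓝[>] 0)
       (𝓝 (c * (∫ u in Set.Ioi (0:ℝ), gpF w (x - u)) +
       ∫ t : ℝ, w t * Complex.exp (Complex.I * t * x) * G (1 + Complex.I * t)).re) := by
      refine (Complex.continuous_re.tendsto _).comp (Tendsto.add (Tendsto.const_mul _ ?_) ?_)
      · apply tendsto_integral_filter_of_dominated_convergence (bound := fun u => ‖gpF w (x - u)‖)
        · refine Eventually.of_forall fun σ => ?_
          have := gpF_cont hw hs
          exact (by fun_prop : Continuous _).aestronglyMeasurable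
        · filter_upwards [self_mem_nhdsWithin] with σ hσ
          filter_upwards [ae_restrict_mem measurableSet_Ioi] with u hu
          rw [norm_mul, Complex.norm_exp]
          have : Real.exp ((-(σ:ℂ) * u).re) ≤ 1 := by
            rw [Real.exp_le_one_iff]
            have e : (-(σ:ℂ) * u).re = -(σ * u) := by simp
            rw [e]
            have := mul_pos (Set.mem_Ioi.mp hσ) (Set.mem_Ioi.mp hu)
            linarith
          exact mul_le_of_le_one_left (norm_nonneg _) this
        · exact (hF.comp_sub_left x).norm.integrableOn
        · refine Eventually.of_forall fun u => ?_
          have : Continuous (fun σ : ℝ => Complex.exp (-σ * u) * gpF w (x - u)) := by fun_prop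
          have h := this.tendsto 0
          simp only [Complex.ofReal_zero, neg_zero, zero_mul, Complex.exp_zero, one_mul] at h
          exact h.mono_left nhdsWithin_le_nhds
      · -- G part
        obtain ⟨R, hR⟩ := hs.isCompact.isBounded.subset_closedBall 0
        have hK : IsCompact ((fun p : ℝ × ℝ => (1 + p.1 + Complex.I * p.2 : ℂ)) '' (Set.Icc 0 1 ×ˢ Metric.closedBall 0 R)) :=
          (isCompact_Icc.prod (isCompact_closedBall _ _)).image (by fun_prop)
        obtain ⟨M, hM⟩ := hK.exists_bound_of_continuousOn (f := G) (hG.mono (by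
          rintro _ ⟨⟨a, t⟩, ⟨ha, _⟩, rfl⟩
          simp [ha.1]))
        apply tendsto_integral_filter_of_dominated_convergence (bound := fun t => ‖w t‖ * M)
        · filter_upwards [self_mem_nhdsWithin] with σ hσ
          have := hGc σ (Set.mem_Ioi.mp hσ).le
          exact ((by fun_prop : Continuous (fun t : ℝ => w t * Complex.exp (Complex.I * t * x))).mul this).aestronglyMeasurable
        · filter_upwards [Ioc_mem_nhdsGT (zero_lt_one' ℝ)] with σ hσ
          refine Eventually.of_forall fun t => ?_
          rw [norm_mul, norm_mul, gp_norm_exp, mul_one]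
          by_cases ht : w t = 0
          · simp [ht]
          · gcongr
            apply hM
            exact ⟨(σ, t), ⟨⟨hσ.1.le, hσ.2⟩, hR (subset_tsupport _ ht)⟩, rfl⟩
        · exact hwi.norm.mul_const _
        · refine Eventually.of_forall fun t => Tendsto.const_mul _ ?_
          have h0 : (1 + Complex.I * t : ℂ) ∈ {s : ℂ | 1 ≤ s.re} := by simp
          refine (hG _ h0).tendsto.comp ?_
          refine tendsto_nhdsWithin_iff.mpr ⟨?_, ?_⟩
          · have : Continuous (fun σ : ℝ => (1 + σ + Complex.I * t : ℂ)) := by fun_prop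
            have h := this.tendsto 0
            simp only [Complex.ofReal_zero, add_zero] at h
            exact h.mono_left nhdsWithin_le_nhds
          · filter_upwards [self_mem_nhdsWithin] with σ hσ
            simp [(Set.mem_Ioi.mp hσ).le]
    exact le_of_tendsto lim (by filter_upwards [self_mem_nhdsWithin] with σ hσ using step σ hσ)
  have lim2 : Tendsto (fun x : ℝ => (c * (∫ u in Set.Ioi (0:ℝ), gpF w (x - u)) +
       ∫ t : ℝ, w t * Complex.exp (Complex.I * t * x) * G (1 + Complex.I * t)).re) atTop
       (𝓝 (c * (∫ u, gpF w u) + 0 : ℂ).re) := by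
    refine (Complex.continuous_re.tendsto _).comp (Tendsto.add (Tendsto.const_mul _ ?_) ?_)
    · have e : ∀ x : ℝ, ∫ u in Set.Ioi (0:ℝ), gpF w (x - u) = ∫ v, (Set.Iio x).indicator (gpF w) v := by
        intro x
        rw [← integral_indicator measurableSet_Ioi, ← integral_sub_left_eq_self _ _ x]
        congr 1; ext u
        simp only [Set.indicator, Set.mem_Ioi, Set.mem_Iio]
        congr 1
        · simp
        · simp
      simp_rw [e]
      apply tendsto_integral_filter_of_dominated_convergence (bound := fun u => ‖gpF w u‖)
      · exact Eventually.of_forall fun x => hF.aestronglyMeasurable.indicator measurableSet_Iio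
      · exact Eventually.of_forall fun x => Eventually.of_forall fun u => norm_indicator_le_norm_self _ _
      · exact hF.norm
      · refine Eventually.of_forall fun u => ?_
        apply tendsto_const_nhds.congr'
        filter_upwards [eventually_gt_atTop u] with x hx
        simp [Set.indicator, hx]
    · have h := (Real.tendsto_integral_exp_smul_cocompact (fun t : ℝ => w t * G (1 + Complex.I * t)))
      have h2 : Tendsto (fun x : ℝ => -(2 * Real.pi)⁻¹ * x) atTop (cocompact ℝ) := by
        refine Tendsto.mono_right ?_ atBot_le_cocompact
        exact tendsto_id.const_mul_atTop_of_neg (by have := Real.pi_pos; simp [this])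
      refine (h.comp h2).congr fun x => ?_
      simp only [Function.comp]
      congr 1; ext t
      rw [Circle.smul_def, Real.fourierChar_apply, smul_eq_mul]
      have : ((2 * Real.pi * -(t * (-(2 * Real.pi)⁻¹ * x)) : ℝ) : ℂ) * Complex.I = Complex.I * t * x := by
        have : 2 * Real.pi * -(t * (-(2 * Real.pi)⁻¹ * x)) = t * x := by
          have := Real.pi_ne_zero
          field_simp
        rw [this]; push_cast; ring
      rw [this]; ring
  by_contra hcon
  rw [not_eventually] at hcon
  have := le_of_tendsto_of_frequently lim2 (b := 0) (hcon.mono fun x hx => main x (by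
    intro n hn
    by_contra h
    exact hx ⟨n, hn, not_le.mp h⟩))
  rw [add_zero, Complex.re_ofReal_mul] at this
  nlinarith [mul_pos hc hpos]

open ArithmeticFunction.vonMangoldt in
lemma gp_inert (η : ℝ) (hη : 0 < η) :
    ∀ᶠ x : ℝ in atTop, ∃ p : ℕ, p.Prime ∧ p % 4 = 3 ∧ |x - Real.log p| < η := by
  have ha : IsUnit (3 : ZMod 4) := by decide
  set b : ℕ → ℝ := fun n => if n.Prime then residueClass (3 : ZMod 4) n else 0 with hb
  set d : ℕ → ℝ := fun n => if n.Prime then 0 else residueClass (3 : ZMod 4) n with hd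
  have hbd : ∀ n, b n = residueClass (3 : ZMod 4) n - d n := by
    intro n; simp only [hb, hd]; split_ifs <;> simp
  have hr : ∀ s : ℂ, 1 < s.re → LSeriesSummable (fun n => (residueClass (3 : ZMod 4) n : ℂ)) s := by
    intro s hs
    apply LSeriesSummable_of_abscissaOfAbsConv_lt_re
    exact (abscissaOfAbsConv_residueClass_le_one (3 : ZMod 4)).trans_lt (by exact_mod_cast hs)
  have hdn : ∀ (n : ℕ) (s : ℂ), 1 ≤ s.re → ‖LSeries.term (fun n => (d n : ℂ)) s n‖ ≤ d n / n := by
    intro n s hs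
    have hd0 : 0 ≤ d n := by
      simp only [hd]; split_ifs; exacts [le_rfl, residueClass_nonneg _ _]
    rw [LSeries.norm_term_eq]
    split_ifs with h
    · simp [h]
    · rw [Complex.norm_real, Real.norm_of_nonneg hd0]
      have h1 : (1 : ℝ) ≤ n := by exact_mod_cast Nat.one_le_iff_ne_zero.mpr h
      gcongr
      calc (n : ℝ) = (n : ℝ) ^ (1 : ℝ) := by simp
        _ ≤ _ := Real.rpow_le_rpow_of_exponent_le h1 hs
  have hds : Summable fun n : ℕ => d n / n := summable_residueClass_non_primes_div (3 : ZMod 4)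
  have hdc : ContinuousOn (fun s => LSeries (fun n => (d n : ℂ)) s) {s | 1 ≤ s.re} := by
    unfold LSeries
    refine continuousOn_tsum (fun n => ?_) hds (fun n s hs => hdn n s hs)
    rcases eq_or_ne n 0 with rfl | hn
    · simp only [LSeries.term_zero]; exact continuousOn_const
    · have hn' : (n : ℂ) ≠ 0 := by exact_mod_cast hn
      have : (fun s => LSeries.term (fun n => (d n : ℂ)) s n) = fun s => (d n : ℂ) / (n : ℂ) ^ s := by
        ext s; rw [LSeries.term_of_ne_zero hn]
      rw [this]
      apply Continuous.continuousOn
      refine continuous_const.div (continuous_id.const_cpow (Or.inl hn')) ?_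
      intro s
      simp [Complex.cpow_eq_zero_iff, hn']
  have hdS : ∀ s : ℂ, 1 ≤ s.re → LSeriesSummable (fun n => (d n : ℂ)) s := fun s hs =>
    Summable.of_norm_bounded hds (fun n => hdn n s hs)
  have hbeq : (fun n => (b n : ℂ)) = (fun n => (residueClass (3 : ZMod 4) n : ℂ)) - (fun n => (d n : ℂ)) := by
    ext n; simp only [Pi.sub_apply, hbd]; push_cast; rfl
  have := gp_tauber b (fun n => by
      simp only [hb]; split_ifs; exacts [residueClass_nonneg _ _, le_rfl])
    (fun s => LFunctionResidueClassAux (3 : ZMod 4) s - LSeries (fun n => (d n : ℂ)) s)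
    ((Nat.totient 4 : ℝ)⁻¹) (by simp [Nat.totient_pos]) 
    ((continuousOn_LFunctionResidueClassAux (3 : ZMod 4)).sub hdc)
    (fun s hs => by rw [hbeq]; exact (hr s hs).sub (hdS s hs.le))
    (fun s hs => by
      rw [hbeq, LSeries_sub (hr s hs) (hdS s hs.le)]
      have := eqOn_LFunctionResidueClassAux ha (show s ∈ {s : ℂ | 1 < s.re} from hs)
      rw [this]; push_cast; ring) η hη
  filter_upwards [this] with x hx
  obtain ⟨n, hn, hx⟩ := hx
  simp only [hb] at hn
  by_cases hp : n.Prime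
  · rw [if_pos hp] at hn
    have h3 : (n : ZMod 4) = 3 := by
      by_contra h
      exact hn (Set.indicator_of_notMem (s := {n : ℕ | (n : ZMod 4) = 3}) h _)
    refine ⟨n, hp, ?_, hx⟩
    have : ((n : ℕ) : ZMod 4) = ((3 : ℕ) : ZMod 4) := by simpa using h3
    simpa using (ZMod.natCast_eq_natCast_iff' n 3 4).mp this
  · simp [hp] at hn

lemma gp_fejer (z : ℂ) (hz : ‖z‖ = 1) (m : ℕ) :
    Complex.normSq (∑ j ∈ Finset.range m, z ^ j) =
      m + 2 * ∑ k ∈ Finset.range m, ((m : ℝ) - (k + 1)) * (z ^ (k + 1)).re := by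
  have hzz : z * (starRingEnd ℂ) z = 1 := by
    rw [Complex.mul_conj, Complex.normSq_eq_norm_sq, hz]; simp
  induction m with
  | zero => simp
  | succ m ih =>
    rw [Finset.sum_range_succ, Complex.normSq_add, ih]
    have h1 : Complex.normSq (z ^ m) = 1 := by
      rw [Complex.normSq_eq_norm_sq, norm_pow, hz]; simp
    have h2 : ((∑ j ∈ Finset.range m, z ^ j) * (starRingEnd ℂ) (z ^ m)).re =
        ∑ k ∈ Finset.range m, (z ^ (k + 1)).re := by
      rw [Finset.sum_mul, Complex.re_sum, ← Finset.sum_range_reflect]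
      refine Finset.sum_congr rfl fun k hk => ?_
      have hk' := Finset.mem_range.mp hk
      have e : m = (m - 1 - k) + (k + 1) := by omega
      have : z ^ (m - 1 - k) * (starRingEnd ℂ) (z ^ m) = (starRingEnd ℂ) (z ^ (k + 1)) := by
        conv_lhs => rw [show (starRingEnd ℂ) (z ^ m) = (starRingEnd ℂ) (z ^ ((m - 1 - k) + (k + 1))) by rw [← e]]
        rw [map_pow, pow_add, ← mul_assoc, ← mul_pow, hzz, one_pow, one_mul, map_pow]
      rw [this, Complex.conj_re]
    rw [h1, h2, Finset.sum_range_succ]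
    push_cast
    have h3 : ∑ k ∈ Finset.range m, ((m : ℝ) + 1 - (k + 1)) * (z ^ (k + 1)).re =
      ∑ k ∈ Finset.range m, ((m : ℝ) - (k + 1)) * (z ^ (k + 1)).re + ∑ k ∈ Finset.range m, (z ^ (k + 1)).re := by
      rw [← Finset.sum_add_distrib]
      refine Finset.sum_congr rfl fun k _ => by ring
    rw [h3]; ring

lemma gp_binom (z : ℂ) (hz : ‖z‖ = 1) (n : ℕ) :
    Complex.normSq (1 + z) ^ n = (Nat.choose (2 * n) n : ℝ) +
      2 * ∑ k ∈ Finset.range n, (Nat.choose (2 * n) (n + k + 1) : ℝ) * (z ^ (k + 1)).re := by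
  have hzz : z * (starRingEnd ℂ) z = 1 := by
    rw [Complex.mul_conj, Complex.normSq_eq_norm_sq, hz]; simp
  have h1 : ((Complex.normSq (1 + z) ^ n : ℝ) : ℂ) = (z + 1) ^ (2 * n) * (starRingEnd ℂ) z ^ n := by
    push_cast
    rw [← Complex.mul_conj, pow_mul, ← mul_pow]
    congr 1
    simp only [map_add, map_one]
    linear_combination (-(z+1)) * hzz
  have h2 : Complex.normSq (1 + z) ^ n = ((z + 1) ^ (2 * n) * (starRingEnd ℂ) z ^ n).re := by
    rw [← h1, Complex.ofReal_re]
  rw [h2, add_pow, Finset.sum_mul, Complex.re_sum, show 2 * n + 1 = n + (n + 1) by ring,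
    Finset.sum_range_add, Finset.sum_range_succ', ← Finset.sum_range_reflect]
  have e0 : ∀ x : ℂ, ∀ j : ℕ, (x * (j : ℂ)).re = x.re * j := by
    intro x j; simp
  have A : ∑ j ∈ Finset.range n, (z ^ (n - 1 - j) * 1 ^ (n + n - (n - 1 - j)) * ((n + n).choose (n - 1 - j) : ℂ) * (starRingEnd ℂ) z ^ n).re
     = ∑ k ∈ Finset.range n, (Nat.choose (2 * n) (n + k + 1) : ℝ) * (z ^ (k + 1)).re := by
    refine Finset.sum_congr rfl fun k hk => ?_
    have hk' := Finset.mem_range.mp hk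
    have e : n = (n - 1 - k) + (k + 1) := by omega
    have t : z ^ (n - 1 - k) * (starRingEnd ℂ) z ^ n = (starRingEnd ℂ) (z ^ (k + 1)) := by
      have : (starRingEnd ℂ) z ^ n = (starRingEnd ℂ) z ^ ((n - 1 - k) + (k + 1)) := by rw [← e]
      rw [this, pow_add, ← mul_assoc, ← mul_pow, hzz, one_pow, one_mul, map_pow]
    have c : (n + n).choose (n - 1 - k) = (2 * n).choose (n + k + 1) := by
      rw [two_mul]
      rw [← Nat.choose_symm (show n - 1 - k ≤ n + n by omega)]
      congr 1; omega
    rw [c, one_pow, mul_one, mul_right_comm, t, e0, Complex.conj_re, mul_comm]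
  have B : ∀ k : ℕ, (z ^ (n + (k + 1)) * 1 ^ (n + n - (n + (k + 1))) * ((n + n).choose (n + (k + 1)) : ℂ) * (starRingEnd ℂ) z ^ n).re
     = (Nat.choose (2 * n) (n + k + 1) : ℝ) * (z ^ (k + 1)).re := by
    intro k
    have t : z ^ (n + (k + 1)) * (starRingEnd ℂ) z ^ n = z ^ (k + 1) := by
      rw [pow_add, mul_right_comm, ← mul_pow, hzz, one_pow, one_mul]
    rw [one_pow, mul_one, mul_right_comm, t, e0, mul_comm, two_mul, add_assoc]
  have Z : (z ^ (n + 0) * 1 ^ (n + n - (n + 0)) * ((n + n).choose (n + 0) : ℂ) * (starRingEnd ℂ) z ^ n).re = (Nat.choose (2 * n) n : ℝ) := by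
    rw [one_pow, mul_one, mul_right_comm, add_zero, ← mul_pow, hzz, one_pow, one_mul, Complex.natCast_re, two_mul]
  simp only [two_mul] at A B Z ⊢
  rw [A, Z]
  simp only [B]
  ring

lemma gp_trig (ζ : ℂ) (hζ : ‖ζ‖ = 1) (δ : ℝ) (hδ : 0 < δ) (hδ1 : δ ≤ 1) :
    ∃ (m : ℕ) (c0 : ℝ) (c : ℕ → ℝ), 0 < c0 ∧ (∀ k < m, c k ≤ 0) ∧
      ∀ z : ℂ, ‖z‖ = 1 → δ ≤ ‖z - ζ‖ → δ ≤ ‖(starRingEnd ℂ) z - ζ‖ →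
        c0 + ∑ k ∈ Finset.range m, c k * (z ^ (k + 1)).re ≤ 0 := by
  set q : ℝ := 4 - δ ^ 2 with hq
  have hq0 : 0 < q := by rw [hq]; nlinarith
  have hq4 : q < 4 := by rw [hq]; nlinarith
  obtain ⟨n, hn1, hn⟩ : ∃ n : ℕ, 1 ≤ n ∧ q ^ n * (4 * n * (n + 1)) < 4 ^ n := by
    have h1 := tendsto_pow_const_mul_const_pow_of_abs_lt_one 2 (r := q / 4) (by rw [abs_of_pos (by positivity)]; linarith)
    have h2 := (h1.eventually (gt_mem_nhds (show (0:ℝ) < 1 / 8 by norm_num))).and (eventually_ge_atTop 1)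
    obtain ⟨n, h3, h4⟩ := h2.exists
    refine ⟨n, h4, ?_⟩
    rw [div_pow, mul_div_assoc', div_lt_iff₀ (by positivity)] at h3
    have h5 : (1:ℝ) ≤ n := by exact_mod_cast h4
    have h6 : 0 < q ^ n := by positivity
    nlinarith [mul_nonneg h6.le (by nlinarith : (0:ℝ) ≤ (n:ℝ)^2 - n)]
  have hn1' : (1:ℝ) ≤ n := by exact_mod_cast hn1
  set a0 : ℝ := (Nat.choose (2 * n) n : ℝ) with ha0
  have ha0l : (4:ℝ) ^ n ≤ 2 * n * a0 := by
    have := Nat.four_pow_le_two_mul_self_mul_centralBinom n hn1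
    rw [Nat.centralBinom] at this
    rw [ha0]; exact_mod_cast this
  have ha0p : 0 < a0 := by
    rw [ha0]; exact_mod_cast Nat.choose_pos (by omega)
  have hak : ∀ k, (Nat.choose (2 * n) (n + k + 1) : ℝ) ≤ a0 * (n / (n + 1)) := by
    intro k
    induction k with
    | zero =>
      have := Nat.choose_succ_right_eq (2 * n) n
      have h2 : ((2 * n).choose (n + 1) : ℝ) * (n + 1) = a0 * n := by
        rw [ha0]; rw [show 2 * n - n = n by omega] at this; exact_mod_cast this
      rw [mul_div_assoc', le_div_iff₀ (by positivity)]
      simpa using h2.le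
    | succ k ih =>
      refine le_trans ?_ ih
      have := Nat.choose_succ_right_eq (2 * n) (n + k + 1)
      have h3 : (2 * n).choose (n + k + 2) * (n + k + 2) ≤ (2 * n).choose (n + k + 1) * (n + k + 2) := by
        rw [show n + k + 2 = n + k + 1 + 1 by ring, this]
        exact Nat.mul_le_mul_left _ (by omega)
      exact_mod_cast Nat.le_of_mul_le_mul_right h3 (by omega)
  set x : ℝ := 1 / (2 * (n + 1)) with hx
  have hx0 : 0 < x := by positivity
  have hx1 : x < 1 := by rw [hx, div_lt_one (by positivity)]; linarith
  set M : ℝ := a0 * (1 - x) with hM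
  have hM0 : 0 < M := mul_pos ha0p (by linarith)
  set m : ℕ := 2 * n * (n + 1) with hm
  have hmn : n ≤ m := by rw [hm]; nlinarith
  have hm0 : (0:ℝ) < m := by rw [hm]; push_cast; positivity
  set c : ℕ → ℝ := fun k => 4 * (Nat.choose (2 * n) (n + k + 1) : ℝ) * (ζ ^ (k + 1)).re - 4 * M / m * (m - (k + 1)) with hc
  refine ⟨m, 2 * a0 - 2 * M - 2 * q ^ n, c, ?_, ?_, ?_⟩
  · have : 2 * a0 - 2 * M = 2 * (a0 * x) := by rw [hM]; ring
    rw [this]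
    have h1 : a0 * x = a0 / (2 * (n + 1)) := by rw [hx]; ring
    have h2 : q ^ n < a0 * x := by
      rw [h1, lt_div_iff₀ (by positivity)]
      by_contra h
      push Not at h
      have : 2 * n * a0 ≤ 2 * n * (q ^ n * (2 * (n + 1))) := by gcongr
      nlinarith
    linarith
  · intro k hkm
    have hkm' : (k:ℝ) + 1 ≤ m := by exact_mod_cast hkm
    simp only [hc]
    have hre : (ζ ^ (k + 1)).re ≤ 1 := by
      refine (Complex.re_le_norm _).trans ?_
      rw [norm_pow, hζ, one_pow]
    rcases lt_or_ge k n with hk | hk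
    · have hk' : (k:ℝ) + 1 ≤ n := by exact_mod_cast hk
      have h1 : (Nat.choose (2 * n) (n + k + 1) : ℝ) * (ζ ^ (k + 1)).re ≤ a0 * (n / (n + 1)) :=
        (mul_le_of_le_one_right (by positivity) hre).trans (hak k)
      have h2 : a0 * (n / (n + 1)) ≤ M / m * (m - (k + 1)) := by
        have e1 : (n : ℝ) / (n + 1) = 1 - 2 * x := by rw [hx]; field_simp; ring
        have e2 : (n : ℝ) / m = x := by rw [hx, hm]; push_cast; field_simp
        have e3 : M / m * (m - n) = M * (1 - x) := by rw [← e2]; field_simp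
        calc a0 * (n / (n + 1)) = a0 * (1 - 2 * x) := by rw [e1]
          _ ≤ a0 * (1 - x) * (1 - x) := by nlinarith [mul_nonneg ha0p.le (sq_nonneg x)]
          _ = M / m * (m - n) := by rw [e3]
          _ ≤ _ := by gcongr
      have : 4 * M / m * (m - (k + 1)) = 4 * (M / m * (m - (k + 1))) := by ring
      rw [this]; linarith
    · rw [Nat.choose_eq_zero_of_lt (by omega)]
      have : 0 ≤ 4 * M / m * (m - (k + 1)) := by
        apply mul_nonneg (by positivity); linarith
      simp; linarith
  · intro z hz h1 h2
    have far : ∀ y : ℂ, ‖y‖ = 1 → δ ≤ ‖y - ζ‖ → Complex.normSq (1 + y * (starRingEnd ℂ) ζ) ^ n ≤ q ^ n := by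
      intro y hy hd
      apply pow_le_pow_left₀ (Complex.normSq_nonneg _)
      have hu : Complex.normSq (y * (starRingEnd ℂ) ζ) = 1 := by
        rw [Complex.normSq_eq_norm_sq, norm_mul, RCLike.norm_conj, hy, hζ]; norm_num
      have e1 : Complex.normSq (y * (starRingEnd ℂ) ζ - 1) = ‖y - ζ‖ ^ 2 := by
        have : y * (starRingEnd ℂ) ζ - 1 = (y - ζ) * (starRingEnd ℂ) ζ := by
          rw [sub_mul, Complex.mul_conj, Complex.normSq_eq_norm_sq ζ, hζ]; simp
        rw [this, Complex.normSq_eq_norm_sq, norm_mul, RCLike.norm_conj, hζ, mul_one]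
      have e2 : Complex.normSq (1 + y * (starRingEnd ℂ) ζ) + Complex.normSq (y * (starRingEnd ℂ) ζ - 1) = 4 := by
        rw [add_comm (1:ℂ), Complex.normSq_add, Complex.normSq_sub, hu]; simp; ring
      rw [hq]; nlinarith [norm_nonneg (y - ζ)]
    have u1 : ‖z * (starRingEnd ℂ) ζ‖ = 1 := by rw [norm_mul, RCLike.norm_conj, hz, hζ, one_mul]
    have u2 : ‖(starRingEnd ℂ) z * (starRingEnd ℂ) ζ‖ = 1 := by
      rw [norm_mul, RCLike.norm_conj, RCLike.norm_conj, hz, hζ, one_mul]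
    have f1 := far z hz h1
    have f2 := far ((starRingEnd ℂ) z) (by rw [RCLike.norm_conj, hz]) h2
    rw [gp_binom _ u1] at f1
    rw [gp_binom _ u2] at f2
    have f3 := Complex.normSq_nonneg (∑ j ∈ Finset.range m, z ^ j)
    rw [gp_fejer z hz] at f3
    have ext : ∀ g : ℕ → ℝ, ∑ k ∈ Finset.range n, (Nat.choose (2 * n) (n + k + 1) : ℝ) * g k =
        ∑ k ∈ Finset.range m, (Nat.choose (2 * n) (n + k + 1) : ℝ) * g k := by
      intro g
      apply Finset.sum_subset (Finset.range_mono hmn)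
      intro k _ hk
      rw [Finset.mem_range, not_lt] at hk
      rw [Nat.choose_eq_zero_of_lt (by omega)]; simp
    rw [ext] at f1 f2
    have key : ∑ k ∈ Finset.range m, c k * (z ^ (k + 1)).re =
        2 * ∑ k ∈ Finset.range m, (Nat.choose (2 * n) (n + k + 1) : ℝ) * ((z * (starRingEnd ℂ) ζ) ^ (k + 1)).re
        + 2 * ∑ k ∈ Finset.range m, (Nat.choose (2 * n) (n + k + 1) : ℝ) * (((starRingEnd ℂ) z * (starRingEnd ℂ) ζ) ^ (k + 1)).re
        - 2 * M / m * (2 * ∑ k ∈ Finset.range m, ((m : ℝ) - (k + 1)) * (z ^ (k + 1)).re) := by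
      simp only [Finset.mul_sum]
      rw [← Finset.sum_add_distrib, ← Finset.sum_sub_distrib]
      refine Finset.sum_congr rfl fun k _ => ?_
      have : ((z * (starRingEnd ℂ) ζ) ^ (k + 1)).re + (((starRingEnd ℂ) z * (starRingEnd ℂ) ζ) ^ (k + 1)).re
        = 2 * ((ζ ^ (k + 1)).re * (z ^ (k + 1)).re) := by
        simp only [mul_pow, ← map_pow, Complex.mul_re, Complex.conj_re, Complex.conj_im]; ring
      simp only [hc]
      linear_combination (-2 * (Nat.choose (2 * n) (n + k + 1) : ℝ)) * this
    have f4 : 0 ≤ 2 * M / m * (m + 2 * ∑ k ∈ Finset.range m, ((m : ℝ) - (k + 1)) * (z ^ (k + 1)).re) :=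
      mul_nonneg (by positivity) f3
    have f5 : 2 * M / m * m = 2 * M := by field_simp
    rw [mul_add, f5] at f4
    rw [key]
    linarith

noncomputable def gpH (k : ℕ) (s : ℝ) (z : ℂ) : ℂ := (z / (‖z‖ : ℂ)) ^ (4 * k) * ((‖z‖ ^ (-2 * s) : ℝ) : ℂ)

lemma gpH_mul (k : ℕ) (s : ℝ) (z w : ℂ) : gpH k s (z * w) = gpH k s z * gpH k s w := by
  unfold gpH
  rw [norm_mul, Real.mul_rpow (norm_nonneg _) (norm_nonneg _)]
  push_cast
  rw [mul_div_mul_comm, mul_pow]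
  ring

lemma gpH_zero (k : ℕ) (s : ℝ) (hs : 0 < s) : gpH k s 0 = 0 := by
  unfold gpH
  rw [norm_zero, Real.zero_rpow (by linarith)]
  simp

lemma gpH_norm_le (k : ℕ) (s : ℝ) (z : ℂ) : ‖gpH k s z‖ ≤ ‖z‖ ^ (-2 * s) := by
  unfold gpH
  rw [norm_mul, norm_pow, norm_div, Complex.norm_real, Complex.norm_real, norm_norm,
    Real.norm_of_nonneg (by positivity : (0:ℝ) ≤ ‖z‖ ^ (-2 * s))]
  have : (‖z‖ / ‖z‖) ^ (4 * k) ≤ 1 := pow_le_one₀ (by positivity) (div_self_le_one _)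
  have h2 : (0:ℝ) ≤ ‖z‖ ^ (-2 * s) := by positivity
  nlinarith

lemma gpH_k0 (s : ℝ) (z : ℂ) : gpH 0 s z = ((‖z‖ ^ (-2 * s) : ℝ) : ℂ) := by
  simp [gpH]

noncomputable def gpf (k : ℕ) (s : ℝ) (α : GaussianInt) : ℂ := gpH k s (GaussianInt.toComplex α)

lemma gp_norm_sq (α : GaussianInt) : ‖GaussianInt.toComplex α‖ ^ 2 = (α.re : ℝ) ^ 2 + (α.im : ℝ) ^ 2 := by
  rw [Complex.sq_norm, Complex.normSq_apply]
  simp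
  ring

lemma gp_norm_sq_int (α : GaussianInt) : ‖GaussianInt.toComplex α‖ ^ 2 = (α.norm : ℝ) := by
  rw [gp_norm_sq, Zsqrtd.norm_def]
  push_cast
  ring

lemma gp_one_le_norm (α : GaussianInt) (h : α ≠ 0) : 1 ≤ ‖GaussianInt.toComplex α‖ := by
  have h1 : 0 < α.norm := GaussianInt.norm_pos.2 h
  have h2 : (1:ℝ) ≤ (α.norm : ℝ) := by exact_mod_cast h1
  rw [← gp_norm_sq_int] at h2
  nlinarith [norm_nonneg (GaussianInt.toComplex α)]

lemma gp_summable (t : ℝ) (ht : 2 < t) : Summable fun α : GaussianInt => ‖GaussianInt.toComplex α‖ ^ (-t) := by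
  have h1 := EisensteinSeries.summable_one_div_norm_rpow ht
  have hinj : Function.Injective (fun α : GaussianInt => (![α.re, α.im] : Fin 2 → ℤ)) := by
    intro a b h
    have h0 := congrFun h 0
    have h1 := congrFun h 1
    simp at h0 h1
    exact Zsqrtd.ext h0 h1
  refine Summable.of_nonneg_of_le (fun α => by positivity) ?_ (h1.comp_injective hinj)
  intro α
  by_cases hα : α = 0
  · subst hα
    simp only [map_zero, norm_zero]
    rw [Real.zero_rpow (by linarith)]
    simp only [Function.comp]
    positivity
  have hle : ‖(![α.re, α.im] : Fin 2 → ℤ)‖ ≤ ‖GaussianInt.toComplex α‖ := by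
    rw [pi_norm_le_iff_of_nonneg (norm_nonneg _)]
    intro i
    have h2 := gp_norm_sq α
    fin_cases i
    · simp only [Fin.zero_eta, Matrix.cons_val_zero, Int.norm_eq_abs]
      refine abs_le_of_sq_le_sq ?_ (norm_nonneg _)
      nlinarith [sq_nonneg (α.im:ℝ)]
    · simp only [Fin.mk_one, Matrix.cons_val_one, Matrix.cons_val_zero, Int.norm_eq_abs]
      refine abs_le_of_sq_le_sq ?_ (norm_nonneg _)
      nlinarith [sq_nonneg (α.re:ℝ)]
  have hpos : 0 < ‖(![α.re, α.im] : Fin 2 → ℤ)‖ := by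
    rw [norm_pos_iff]
    intro h
    exact hα (hinj (by simp only [h]; ext i; fin_cases i <;> simp))
  exact Real.rpow_le_rpow_of_nonpos hpos hle (by linarith)

lemma gpf_zero (k : ℕ) (s : ℝ) (hs : 0 < s) : gpf k s 0 = 0 := by
  simp [gpf, gpH_zero k s hs]

lemma gpf_mul (k : ℕ) (s : ℝ) (a b : GaussianInt) : gpf k s (a * b) = gpf k s a * gpf k s b := by
  simp [gpf, gpH_mul]

lemma gpf_norm_le (k : ℕ) (s : ℝ) (a : GaussianInt) : ‖gpf k s a‖ ≤ ‖GaussianInt.toComplex a‖ ^ (-2 * s) :=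
  gpH_norm_le _ _ _

lemma gp_unit_norm (a : GaussianInt) (h : IsUnit a) : ‖GaussianInt.toComplex a‖ = 1 := by
  have h1 := (Zsqrtd.norm_eq_one_iff (x := a)).2 h
  have h2 : a.norm = 1 := by
    have := GaussianInt.norm_nonneg a
    omega
  have h3 := gp_norm_sq_int a
  rw [h2] at h3
  have := norm_nonneg (GaussianInt.toComplex a)
  push_cast at h3
  nlinarith

lemma gp_unit_pow (a : GaussianInt) (h : IsUnit a) : a ^ 4 = 1 := by
  have h1 := (Zsqrtd.norm_eq_one_iff (x := a)).2 h
  have h2 : a.norm = 1 := by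
    have := GaussianInt.norm_nonneg a
    omega
  rw [Zsqrtd.norm_def] at h2
  obtain ⟨x, y⟩ := a
  simp only at h2
  have hx : x ≤ 1 := by nlinarith [sq_nonneg y, sq_nonneg x]
  have hx' : -1 ≤ x := by nlinarith [sq_nonneg y, sq_nonneg x]
  have hy : y ≤ 1 := by nlinarith [sq_nonneg y, sq_nonneg x]
  have hy' : -1 ≤ y := by nlinarith [sq_nonneg y, sq_nonneg x]
  interval_cases x <;> interval_cases y <;> simp_all <;> decide

lemma gpf_unit (k : ℕ) (s : ℝ) (a : GaussianInt) (h : IsUnit a) : gpf k s a = 1 := by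
  unfold gpf gpH
  rw [gp_unit_norm a h, pow_mul, Complex.ofReal_one, div_one, ← map_pow, gp_unit_pow a h]
  simp

lemma gpf_summable (k : ℕ) (s : ℝ) (hs : 1 < s) : Summable (gpf k s) := by
  apply Summable.of_norm_bounded (gp_summable (2 * s) (by linarith))
  intro a
  have := gpf_norm_le k s a
  rwa [neg_mul] at this

lemma gp_pow_sub (n : ℕ) (u v : ℂ) (hu : ‖u‖ ≤ 1) (hv : ‖v‖ ≤ 1) : ‖u ^ n - v ^ n‖ ≤ n * ‖u - v‖ := by
  induction n with
  | zero => simp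
  | succ n ih =>
    have : u ^ (n + 1) - v ^ (n + 1) = u ^ n * (u - v) + (u ^ n - v ^ n) * v := by ring
    rw [this]
    have h1 : ‖u ^ n‖ ≤ 1 := by rw [norm_pow]; exact pow_le_one₀ (norm_nonneg _) hu
    calc _ ≤ ‖u ^ n * (u - v)‖ + ‖(u ^ n - v ^ n) * v‖ := norm_add_le _ _
      _ = ‖u ^ n‖ * ‖u - v‖ + ‖u ^ n - v ^ n‖ * ‖v‖ := by rw [norm_mul, norm_mul]
      _ ≤ 1 * ‖u - v‖ + ‖u ^ n - v ^ n‖ * 1 := by gcongr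
      _ ≤ _ := by push_cast; linarith

lemma gp_rpow_diff (s x y m : ℝ) (hs : 1 ≤ s) (hs2 : s ≤ 2) (hm : 1 ≤ m) (hx : m ≤ x) (hy : m ≤ y) :
    |x ^ (-2 * s) - y ^ (-2 * s)| ≤ 4 * m ^ (-3 : ℝ) * |x - y| := by
  have := (convex_Ici m).norm_image_sub_le_of_norm_hasDerivWithin_le
    (f := fun x : ℝ => x ^ (-2 * s)) (f' := fun x : ℝ => (-2 * s) * x ^ (-2 * s - 1))
    (C := 4 * m ^ (-3 : ℝ)) (x := y) (y := x) ?_ ?_ hy hx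
  · simpa using this
  · intro t ht
    have ht' : m ≤ t := ht
    exact (Real.hasDerivAt_rpow_const (Or.inl (by linarith))).hasDerivWithinAt
  · intro t ht
    have ht' : m ≤ t := ht
    have h0 : 0 < t := by linarith
    rw [norm_mul, Real.norm_of_nonneg (by positivity : (0:ℝ) ≤ t ^ (-2 * s - 1)), Real.norm_eq_abs]
    have e1 : |-2 * s| ≤ 4 := by rw [abs_le]; constructor <;> linarith
    have e2 : t ^ (-2 * s - 1) ≤ m ^ (-3 : ℝ) := by
      calc t ^ (-2 * s - 1) ≤ t ^ (-3 : ℝ) := Real.rpow_le_rpow_of_exponent_le (by linarith) (by linarith)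
        _ ≤ _ := Real.rpow_le_rpow_of_nonpos (by linarith) ht' (by norm_num)
    gcongr

lemma gp_unit_diff (z w : ℂ) (hz : z ≠ 0) (hw : w ≠ 0) : ‖z / (‖z‖ : ℂ) - w / (‖w‖ : ℂ)‖ ≤ 2 * ‖z - w‖ / ‖w‖ := by
  have hz' : (0:ℝ) < ‖z‖ := norm_pos_iff.2 hz
  have hw' : (0:ℝ) < ‖w‖ := norm_pos_iff.2 hw
  have hzc : (‖z‖ : ℂ) ≠ 0 := by exact_mod_cast hz'.ne'
  have hwc : (‖w‖ : ℂ) ≠ 0 := by exact_mod_cast hw'.ne'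
  have e : z / (‖z‖ : ℂ) - w / (‖w‖ : ℂ) = (z / (‖z‖ : ℂ) * ((‖w‖ - ‖z‖ : ℝ) : ℂ) + (z - w)) / (‖w‖ : ℂ) := by
    push_cast
    field_simp
    ring
  rw [e, norm_div, Complex.norm_real, norm_norm]
  gcongr
  calc _ ≤ ‖z / (‖z‖ : ℂ) * ((‖w‖ - ‖z‖ : ℝ) : ℂ)‖ + ‖z - w‖ := norm_add_le _ _
    _ = |‖w‖ - ‖z‖| + ‖z - w‖ := by
      rw [norm_mul, norm_div, Complex.norm_real, Complex.norm_real, norm_norm, div_self hz'.ne', one_mul,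
        Real.norm_eq_abs]
    _ ≤ ‖z - w‖ + ‖z - w‖ := by
      gcongr
      rw [abs_sub_comm]
      exact abs_norm_sub_norm_le z w
    _ = _ := by ring

lemma gp_unit_le (z : ℂ) : ‖z / (‖z‖ : ℂ)‖ ≤ 1 := by
  rw [norm_div, Complex.norm_real, norm_norm]
  exact div_self_le_one _

lemma gpH_diff (k : ℕ) (s : ℝ) (hs : 1 ≤ s) (hs2 : s ≤ 2) (z w : ℂ) (hw : 8 ≤ ‖w‖) (hzw : ‖z - w‖ ≤ 4) :
    ‖gpH k s z - gpH k s w‖ ≤ (128 * k + 128) * ‖w‖ ^ (-3 : ℝ) := by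
  have hzn : ‖w‖ / 2 ≤ ‖z‖ := by
    have := norm_sub_norm_le w z
    rw [norm_sub_rev] at this
    linarith
  have hwp : 0 < ‖w‖ := by linarith
  have hz : z ≠ 0 := by
    rw [← norm_pos_iff]; linarith
  have hw0 : w ≠ 0 := by
    rw [← norm_pos_iff]; linarith
  have h1 := gp_unit_diff z w hz hw0
  have h2 := gp_pow_sub (4 * k) _ _ (gp_unit_le z) (gp_unit_le w)
  have h3 := gp_rpow_diff s ‖z‖ ‖w‖ (‖w‖ / 2) hs hs2 (by linarith) hzn (by linarith)
  have h4 : |‖z‖ - ‖w‖| ≤ 4 := (abs_norm_sub_norm_le z w).trans hzw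
  have e : gpH k s z - gpH k s w = ((z / (‖z‖ : ℂ)) ^ (4 * k) - (w / (‖w‖ : ℂ)) ^ (4 * k)) * ((‖w‖ ^ (-2 * s) : ℝ) : ℂ)
      + (z / (‖z‖ : ℂ)) ^ (4 * k) * ((‖z‖ ^ (-2 * s) - ‖w‖ ^ (-2 * s) : ℝ) : ℂ) := by
    unfold gpH
    push_cast
    ring
  have h5 : (‖w‖ / 2) ^ (-3 : ℝ) = 8 * ‖w‖ ^ (-3 : ℝ) := by
    rw [Real.div_rpow hwp.le (by norm_num), Real.rpow_neg (by norm_num : (0:ℝ) ≤ 2)]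
    norm_num
    ring
  have h6 : ‖w‖ ^ (-2 * s) ≤ ‖w‖ ^ (-3 : ℝ) * ‖w‖ := by
    calc ‖w‖ ^ (-2 * s) ≤ ‖w‖ ^ (-2 : ℝ) := Real.rpow_le_rpow_of_exponent_le (by linarith) (by linarith)
      _ = ‖w‖ ^ (-3 : ℝ) * ‖w‖ := by
        rw [← Real.rpow_add_one hwp.ne']; norm_num
  have h7 : ‖(z / (‖z‖ : ℂ)) ^ (4 * k)‖ ≤ 1 := by
    rw [norm_pow]; exact pow_le_one₀ (norm_nonneg _) (gp_unit_le z)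
  rw [e]
  calc _ ≤ _ := norm_add_le _ _
    _ = ‖(z / (‖z‖ : ℂ)) ^ (4 * k) - (w / (‖w‖ : ℂ)) ^ (4 * k)‖ * ‖w‖ ^ (-2 * s)
      + ‖(z / (‖z‖ : ℂ)) ^ (4 * k)‖ * |‖z‖ ^ (-2 * s) - ‖w‖ ^ (-2 * s)| := by
      rw [norm_mul, norm_mul, Complex.norm_real, Complex.norm_real, Real.norm_of_nonneg (by positivity), Real.norm_eq_abs]
    _ ≤ ((4 * k : ℕ) * (2 * 4 / ‖w‖)) * (‖w‖ ^ (-3 : ℝ) * ‖w‖) + 1 * (4 * (8 * ‖w‖ ^ (-3 : ℝ)) * 4) := by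
      gcongr
      · refine h2.trans ?_
        gcongr
        refine h1.trans ?_
        gcongr
      · rw [h5] at h3
        refine h3.trans ?_
        gcongr
    _ ≤ _ := by
      have : 0 ≤ ‖w‖ ^ (-3 : ℝ) := by positivity
      have e2 : ((4 * k : ℕ) * (2 * 4 / ‖w‖)) * (‖w‖ ^ (-3 : ℝ) * ‖w‖) = 32 * k * ‖w‖ ^ (-3 : ℝ) := by
        push_cast
        field_simp
        ring
      rw [e2]
      have : 0 ≤ (k:ℝ) * ‖w‖ ^ (-3 : ℝ) := by positivity
      linarith

def gpE : GaussianInt × Fin 5 ≃ GaussianInt where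
  toFun p := ⟨2, 1⟩ * p.1 + ((p.2 : ℕ) : GaussianInt)
  invFun a := (⟨a.im + 2 * ((a.re - 2 * a.im) / 5), -((a.re - 2 * a.im) / 5)⟩,
    ⟨((a.re - 2 * a.im) % 5).toNat, by omega⟩)
  left_inv := by
    rintro ⟨⟨x, y⟩, ⟨r, hr⟩⟩
    ext <;> simp <;> omega
  right_inv := by
    rintro ⟨m, n⟩
    have h : ((((m - 2 * n) % 5).toNat : ℕ) : ℤ) = (m - 2 * n) % 5 := by omega
    ext
    · simp
      omega
    · simp

lemma gp_rot_ne (k : ℕ) (hk : 1 ≤ k) : (GaussianInt.toComplex ⟨2, 1⟩ / (‖GaussianInt.toComplex ⟨2, 1⟩‖ : ℂ)) ^ (4 * k) ≠ 1 := by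
  intro h
  have key : ∀ n : ℕ, ((⟨2, 1⟩ : GaussianInt) ^ (n + 1)).re % 5 = 2 * ((⟨2, 1⟩ : GaussianInt) ^ (n + 1)).im % 5 ∧
      ((⟨2, 1⟩ : GaussianInt) ^ (n + 1)).im % 5 ≠ 0 := by
    intro n
    induction n with
    | zero => simp
    | succ n ih =>
      rw [pow_succ]
      simp only [Zsqrtd.re_mul, Zsqrtd.im_mul]
      omega
  have hn : ‖GaussianInt.toComplex ⟨2, 1⟩‖ ^ 2 = 5 := by
    rw [gp_norm_sq]; norm_num
  have hnc : (‖GaussianInt.toComplex ⟨2, 1⟩‖ : ℂ) ^ 2 = 5 := by exact_mod_cast hn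
  rw [div_pow, div_eq_one_iff_eq, show 4 * k = 2 * (2 * k) by ring, pow_mul (‖GaussianInt.toComplex ⟨2, 1⟩‖ : ℂ), hnc,
    ← map_pow] at h
  · have h2 := congrArg Complex.im h
    obtain ⟨n, hn⟩ : ∃ n, 2 * (2 * k) = n + 1 := ⟨2 * (2 * k) - 1, by omega⟩
    have h3 := (key n).2
    rw [← hn] at h3
    have h4 : ((5 : ℂ) ^ (2 * k)).im = 0 := by
      have : ((5 : ℂ) ^ (2 * k)) = (((5:ℝ) ^ (2 * k) : ℝ) : ℂ) := by push_cast; rfl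
      rw [this, Complex.ofReal_im]
    rw [h4, ← GaussianInt.intCast_im] at h2
    have h5 : ((⟨2, 1⟩ : GaussianInt) ^ (2 * (2 * k))).im = 0 := by exact_mod_cast h2
    rw [h5] at h3
    simp at h3
  · apply pow_ne_zero
    intro h0
    rw [h0] at hnc
    norm_num at hnc

lemma gpf_le_one (k : ℕ) (s : ℝ) (hs : 0 < s) (a : GaussianInt) : ‖gpf k s a‖ ≤ 1 := by
  by_cases h : a = 0
  · subst h; rw [gpf_zero k s hs]; simp
  · refine (gpf_norm_le k s a).trans ?_
    exact Real.rpow_le_one_of_one_le_of_nonpos (gp_one_le_norm a h) (by linarith)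

lemma gpE_diff (k : ℕ) (s : ℝ) (hs : 1 ≤ s) (hs2 : s ≤ 2) (p : GaussianInt × Fin 5) :
    ‖gpf k s (gpE p) - gpf k s (⟨2, 1⟩ * p.1)‖ ≤ (128 * k + 2000) * ‖GaussianInt.toComplex p.1‖ ^ (-3 : ℝ)
      + (if p.1 = 0 then 2 else 0) := by
  obtain ⟨b, r⟩ := p
  simp only
  have hA : (0:ℝ) ≤ ‖GaussianInt.toComplex b‖ ^ (-3 : ℝ) := by positivity
  have hk : (0:ℝ) ≤ (k : ℝ) * ‖GaussianInt.toComplex b‖ ^ (-3 : ℝ) := by positivity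
  have htriv : ‖gpf k s (gpE (b, r)) - gpf k s (⟨2, 1⟩ * b)‖ ≤ 2 := by
    refine (norm_sub_le _ _).trans ?_
    have h1 := gpf_le_one k s (by linarith) (gpE (b, r))
    have h2 := gpf_le_one k s (by linarith) (⟨2, 1⟩ * b)
    linarith
  by_cases hb : b = 0
  · rw [if_pos hb]
    nlinarith
  rw [if_neg hb, add_zero]
  have hb1 := gp_one_le_norm b hb
  have hn : ‖GaussianInt.toComplex ⟨2, 1⟩‖ ^ 2 = 5 := by
    rw [gp_norm_sq]; norm_num
  have hn1 : 1 ≤ ‖GaussianInt.toComplex ⟨2, 1⟩‖ := by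
    nlinarith [norm_nonneg (GaussianInt.toComplex ⟨2, 1⟩)]
  have hwb : ‖GaussianInt.toComplex b‖ ≤ ‖GaussianInt.toComplex (⟨2, 1⟩ * b)‖ := by
    rw [map_mul, norm_mul]; nlinarith
  by_cases h8 : 8 ≤ ‖GaussianInt.toComplex b‖
  · have := gpH_diff k s hs hs2 (GaussianInt.toComplex (gpE (b, r))) (GaussianInt.toComplex (⟨2, 1⟩ * b))
      (by linarith) (by
        have : gpE (b, r) = ⟨2, 1⟩ * b + ((r : ℕ) : GaussianInt) := rfl
        rw [this, map_add, add_sub_cancel_left, map_natCast, Complex.norm_natCast]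
        have := r.2
        have h : (r : ℕ) ≤ 4 := by omega
        exact_mod_cast h)
    refine this.trans ?_
    have h3 : ‖GaussianInt.toComplex (⟨2, 1⟩ * b)‖ ^ (-3 : ℝ) ≤ ‖GaussianInt.toComplex b‖ ^ (-3 : ℝ) :=
      Real.rpow_le_rpow_of_nonpos (by linarith) hwb (by norm_num)
    gcongr
    norm_num
  · push Not at h8
    have h3 : (8:ℝ) ^ (-3 : ℝ) ≤ ‖GaussianInt.toComplex b‖ ^ (-3 : ℝ) :=
      Real.rpow_le_rpow_of_nonpos (by linarith) h8.le (by norm_num)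
    have h4 : (8:ℝ) ^ (-3 : ℝ) = 1 / 512 := by
      rw [Real.rpow_neg (by norm_num)]; norm_num
    rw [h4] at h3
    linarith

set_option maxHeartbeats 1000000 in
lemma gp_L_bdd (k : ℕ) (hk : 1 ≤ k) : ∃ C : ℝ, ∀ᶠ s in 𝓝[>] (1:ℝ), ‖∑' α, gpf k s α‖ ≤ C := by
  set B : GaussianInt × Fin 5 → ℝ := fun p => (128 * k + 2000) * ‖GaussianInt.toComplex p.1‖ ^ (-3 : ℝ)
      + (if p.1 = 0 then 2 else 0) with hB
  have hBs : Summable B := by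
    have h0 : Summable (fun b : GaussianInt => (128 * k + 2000) * ‖GaussianInt.toComplex b‖ ^ (-3 : ℝ)
      + (if b = 0 then (2:ℝ) else 0)) := by
      refine Summable.add ((gp_summable 3 (by norm_num)).mul_left _) ?_
      exact summable_of_ne_finset_zero (s := {0}) (by
        intro b hb
        rw [if_neg (by simpa using hb)])
    have h1 : Summable (fun _ : Fin 5 => (1:ℝ)) := Summable.of_finite
    have h2 := h0.mul_of_nonneg h1 (fun b => by positivity) (fun _ => by norm_num)
    simpa [hB] using h2
  set u := (GaussianInt.toComplex ⟨2, 1⟩ / (‖GaussianInt.toComplex ⟨2, 1⟩‖ : ℂ)) ^ (4 * k) with hu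
  set c := ‖GaussianInt.toComplex ⟨2, 1⟩‖ with hc
  have hc2 : c ^ 2 = 5 := by
    rw [hc, gp_norm_sq]; norm_num
  have hc0 : 0 < c := by
    rcases (norm_nonneg (GaussianInt.toComplex ⟨2, 1⟩)).lt_or_eq with h | h
    · exact h
    · rw [hc, ← h] at hc2; norm_num at hc2
  have hu1 : u ≠ 1 := gp_rot_ne k hk
  set G : ℝ → ℂ := fun s => 1 - 5 * (u * ((c ^ (-2 * s) : ℝ) : ℂ)) with hG
  have hGc : Continuous G := by
    have : Continuous fun s : ℝ => c ^ (-2 * s) := 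
      continuous_const.rpow (by fun_prop) (fun _ => Or.inl hc0.ne')
    have := Complex.continuous_ofReal.comp this
    simp only [hG]
    fun_prop
  have hG1 : G 1 ≠ 0 := by
    have : c ^ (-2 * (1:ℝ)) = 1 / 5 := by
      rw [mul_one, Real.rpow_neg hc0.le]
      norm_num
      rw [hc2]
      norm_num
    simp only [hG, this]
    intro h
    apply hu1
    push_cast at h
    linear_combination -h
  have hGpos : 0 < ‖G 1‖ := norm_pos_iff.2 hG1
  have hev : ∀ᶠ s in 𝓝[>] (1:ℝ), ‖G 1‖ / 2 < ‖G s‖ := by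
    have : Tendsto (fun s => ‖G s‖) (𝓝 1) (𝓝 ‖G 1‖) := (hGc.norm.tendsto 1)
    exact nhdsWithin_le_nhds (this.eventually (lt_mem_nhds (by linarith)))
  refine ⟨(∑' p, B p) / (‖G 1‖ / 2), ?_⟩
  have h2 : ∀ᶠ s in 𝓝[>] (1:ℝ), s < 2 := nhdsWithin_le_nhds (gt_mem_nhds (by norm_num))
  filter_upwards [hev, h2, self_mem_nhdsWithin] with s hs hs2 hs1
  have hs1 : 1 < s := hs1
  have hsum := gpf_summable k s hs1
  have e1 : ∑' p, gpf k s (gpE p) = ∑' α, gpf k s α := gpE.tsum_eq _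
  have s1 : Summable (fun p => gpf k s (gpE p)) := (gpE.summable_iff).2 hsum
  have s2 : Summable (fun p : GaussianInt × Fin 5 => gpf k s (⟨2, 1⟩ * p.1)) := by
    have hd : Summable (fun p : GaussianInt × Fin 5 => gpf k s (gpE p) - gpf k s (⟨2, 1⟩ * p.1)) :=
      Summable.of_norm_bounded hBs (fun p => gpE_diff k s hs1.le hs2.le p)
    simpa using s1.sub hd
  have e2 : ∑' p : GaussianInt × Fin 5, gpf k s (⟨2, 1⟩ * p.1) = 5 * (gpf k s ⟨2, 1⟩ * ∑' α, gpf k s α) := by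
    rw [s2.tsum_prod]
    simp only [tsum_fintype, gpf_mul, Finset.sum_const, Finset.card_univ, Fintype.card_fin, nsmul_eq_mul]
    rw [tsum_mul_left, tsum_mul_left]
    norm_num
  have e3 : gpf k s ⟨2, 1⟩ = u * ((c ^ (-2 * s) : ℝ) : ℂ) := rfl
  have e4 : (∑' α, gpf k s α) * G s = ∑' p : GaussianInt × Fin 5, (gpf k s (gpE p) - gpf k s (⟨2, 1⟩ * p.1)) := by
    rw [s1.tsum_sub s2, e1, e2, e3]
    simp only [hG]
    ring
  have e5 : ‖(∑' α, gpf k s α) * G s‖ ≤ ∑' p, B p := by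
    rw [e4]
    exact tsum_of_norm_bounded hBs.hasSum (fun p => gpE_diff k s hs1.le hs2.le p)
  rw [norm_mul] at e5
  rw [le_div_iff₀ (by linarith)]
  refine le_trans ?_ e5
  gcongr

def gpR : Set GaussianInt := {π | Prime π ∧ Quot.out (Associates.mk π) = π}

lemma gpR_eq (a b : gpR) (h : (a : GaussianInt) ∣ b) : a = b := by
  obtain ⟨a, ha, ha'⟩ := a
  obtain ⟨b, hb, hb'⟩ := b
  have h1 : Associated a b := ha.associated_of_dvd hb h
  have h2 := Associates.mk_eq_mk_iff_associated.2 h1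
  apply Subtype.ext
  simp only
  rw [← ha', ← hb', h2]

lemma gpR_exists (α : GaussianInt) (h0 : α ≠ 0) (hu : ¬ IsUnit α) : ∃ π : gpR, (π : GaussianInt) ∣ α := by
  obtain ⟨p, hp, hpa⟩ := WfDvdMonoid.exists_irreducible_factor hu h0
  have hpp : Prime p := hp.prime
  have hm : Associates.mk (Quot.out (Associates.mk p)) = Associates.mk p := Associates.quot_out _
  have has : Associated (Quot.out (Associates.mk p)) p := Associates.mk_eq_mk_iff_associated.1 hm
  refine ⟨⟨Quot.out (Associates.mk p), (has.prime_iff).2 hpp, ?_⟩, has.dvd.trans hpa⟩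
  rw [hm]

open Classical in
lemma gp_sieve (f : GaussianInt → ℂ) (hf : Summable f) (hm : ∀ a b, f (a * b) = f a * f b) (P : Finset gpR) :
    (∑' α, f α) * ∏ π ∈ P, (1 - f π) = ∑' α, if (∀ π ∈ P, ¬ (π : GaussianInt) ∣ α) then f α else 0 := by
  induction P using Finset.induction_on with
  | empty => simp
  | insert π P hπ ih =>
    rw [Finset.prod_insert hπ, mul_comm (1 - f π), ← mul_assoc, ih]
    set g : GaussianInt → ℂ := fun α => if (∀ π ∈ P, ¬ (π : GaussianInt) ∣ α) then f α else 0 with hg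
    have hgs : Summable g := by
      refine Summable.of_norm_bounded hf.norm (fun α => ?_)
      simp only [hg]
      split_ifs <;> simp
    have hπp : Prime (π : GaussianInt) := π.2.1
    have h1 : ∀ α, g α * f π = g (π * α) := by
      intro α
      simp only [hg]
      have : (∀ ρ ∈ P, ¬ (ρ : GaussianInt) ∣ α) ↔ (∀ ρ ∈ P, ¬ (ρ : GaussianInt) ∣ π * α) := by
        constructor
        · intro h ρ hρ hd
          rcases (ρ.2.1 : Prime (ρ : GaussianInt)).dvd_or_dvd hd with h' | h'
          · rw [gpR_eq ρ π h'] at hρ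
            exact hπ hρ
          · exact h ρ hρ h'
        · intro h ρ hρ hd
          exact h ρ hρ (hd.mul_left _)
      by_cases hc : ∀ ρ ∈ P, ¬ (ρ : GaussianInt) ∣ α
      · rw [if_pos hc, if_pos (this.1 hc), hm]; ring
      · rw [if_neg hc, if_neg (fun h => hc (this.2 h))]; ring
    have hinj : Function.Injective (fun α : GaussianInt => (π : GaussianInt) * α) := mul_right_injective₀ hπp.ne_zero
    set k : GaussianInt → ℂ := fun β => if (π : GaussianInt) ∣ β then g β else 0 with hk
    have hks : Summable k := by
      refine Summable.of_norm_bounded hgs.norm (fun α => ?_)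
      simp only [hk]
      split_ifs <;> simp
    have h2 : ∑' α, g (π * α) = ∑' β, k β := by
      rw [← hinj.tsum_eq (f := k)]
      · apply tsum_congr
        intro α
        simp [hk]
      · intro β hβ
        simp only [hk, Function.mem_support, ne_eq, ite_eq_right_iff, Classical.not_imp] at hβ
        obtain ⟨⟨γ, hγ⟩, -⟩ := hβ
        exact ⟨γ, hγ.symm⟩
    rw [mul_sub, mul_one, ← tsum_mul_right, tsum_congr h1, h2, ← hgs.tsum_sub hks]
    apply tsum_congr
    intro α
    simp only [hk, hg, Finset.forall_mem_insert]
    by_cases c1 : (π : GaussianInt) ∣ α <;> by_cases c2 : ∀ ρ ∈ P, ¬ (ρ : GaussianInt) ∣ α <;> simp [c1, c2]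

open Classical in
noncomputable def gpU : ℝ := ∑' α : GaussianInt, if IsUnit α then (1:ℝ) else 0

lemma gpU_one_le : 1 ≤ gpU := by
  classical
  unfold gpU
  have hs : Summable (fun α : GaussianInt => if IsUnit α then (1:ℝ) else 0) := by
    refine Summable.of_nonneg_of_le (fun α => by split_ifs <;> norm_num) (fun α => ?_) (gp_summable 3 (by norm_num))
    split_ifs with h
    · rw [gp_unit_norm α h]; simp
    · positivity
  have := hs.le_tsum (1 : GaussianInt) (fun α _ => by split_ifs <;> norm_num)
  rw [if_pos isUnit_one] at this
  convert this

lemma gp_euler (k : ℕ) (s : ℝ) (hs : 1 < s) :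
    Tendsto (fun P : Finset gpR => (∑' α, gpf k s α) * ∏ π ∈ P, (1 - gpf k s π)) atTop (𝓝 (gpU : ℂ)) := by
  classical
  have hsum := gpf_summable k s hs
  simp_rw [gp_sieve (gpf k s) hsum (gpf_mul k s)]
  have : (gpU : ℂ) = ∑' α : GaussianInt, if IsUnit α then gpf k s α else 0 := by
    unfold gpU
    rw [Complex.ofReal_tsum]
    apply tsum_congr
    intro α
    split_ifs with h
    · rw [gpf_unit k s α h]; simp
    · simp
  rw [this]
  refine tendsto_tsum_of_dominated_convergence hsum.norm (fun α => ?_) (Eventually.of_forall fun P α => ?_)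
  · by_cases h0 : α = 0
    · subst h0
      simp [gpf_zero k s (by linarith)]
    by_cases hu : IsUnit α
    · apply tendsto_const_nhds.congr
      intro P
      rw [if_pos hu, if_pos]
      intro π _ hd
      exact (π.2.1 : Prime (π : GaussianInt)).not_isUnit (isUnit_of_dvd_unit hd hu)
    · obtain ⟨π, hπ⟩ := gpR_exists α h0 hu
      apply tendsto_const_nhds.congr'
      filter_upwards [eventually_ge_atTop ({π} : Finset gpR)] with P hP
      rw [if_neg hu, if_neg]
      intro h
      exact h π (hP (by simp)) hπ
  · split_ifs <;> simp

noncomputable def gpX (k : ℕ) (s : ℝ) : ℝ := ∑' π : gpR, (gpf k s π).re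

lemma gpf_summable_R (k : ℕ) (s : ℝ) (hs : 1 < s) : Summable (fun π : gpR => gpf k s π) :=
  (gpf_summable k s hs).subtype gpR

lemma gpX_summable (k : ℕ) (s : ℝ) (hs : 1 < s) : Summable (fun π : gpR => (gpf k s π).re) :=
  (Complex.hasSum_re (gpf_summable_R k s hs).hasSum).summable

lemma gp_one_sub_norm (z : ℂ) : ‖1 - z‖ ≤ Real.exp (-z.re + ‖z‖ ^ 2 / 2) := by
  refine le_of_sq_le_sq ?_ (Real.exp_pos _).le
  rw [← Real.exp_nat_mul]
  have h1 : ‖1 - z‖ ^ 2 = 1 - 2 * z.re + ‖z‖ ^ 2 := by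
    rw [Complex.sq_norm, Complex.sq_norm, Complex.normSq_apply, Complex.normSq_apply]
    simp
    ring
  rw [h1]
  have := Real.add_one_le_exp (-2 * z.re + ‖z‖ ^ 2)
  have e : ((2:ℕ):ℝ) * (-z.re + ‖z‖ ^ 2 / 2) = -2 * z.re + ‖z‖ ^ 2 := by push_cast; ring
  rw [e]
  linarith

noncomputable def gpD : ℝ := ∑' π : gpR, ‖GaussianInt.toComplex π‖ ^ (-4 : ℝ)

lemma gpf_sq_le (k : ℕ) (s : ℝ) (hs : 1 < s) (π : gpR) : ‖gpf k s π‖ ^ 2 ≤ ‖GaussianInt.toComplex π‖ ^ (-4 : ℝ) := by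
  have h1 : 1 ≤ ‖GaussianInt.toComplex π‖ := gp_one_le_norm _ (π.2.1 : Prime (π : GaussianInt)).ne_zero
  have h2 : ‖gpf k s π‖ ≤ ‖GaussianInt.toComplex π‖ ^ (-2 : ℝ) := by
    refine (gpf_norm_le k s π).trans ?_
    exact Real.rpow_le_rpow_of_exponent_le h1 (by linarith)
  calc ‖gpf k s π‖ ^ 2 ≤ (‖GaussianInt.toComplex π‖ ^ (-2 : ℝ)) ^ 2 := by gcongr
    _ = _ := by
      rw [← Real.rpow_mul_natCast (norm_nonneg _)]
      norm_num

lemma gp_upper (k : ℕ) (s : ℝ) (hs : 1 < s) : 1 ≤ ‖∑' α, gpf k s α‖ * Real.exp (-gpX k s + gpD / 2) := by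
  have hD : Summable (fun π : gpR => ‖GaussianInt.toComplex π‖ ^ (-4 : ℝ)) :=
    (gp_summable 4 (by norm_num)).subtype gpR
  have hq : Summable (fun π : gpR => ‖gpf k s π‖ ^ 2) :=
    Summable.of_nonneg_of_le (fun _ => by positivity) (gpf_sq_le k s hs) hD
  have t1 := (gp_euler k s hs).norm
  have hU : ‖(gpU : ℂ)‖ = gpU := by
    rw [Complex.norm_real, Real.norm_of_nonneg (by linarith [gpU_one_le])]
  rw [hU] at t1
  have hsum : Summable (fun π : gpR => -(gpf k s π).re + ‖gpf k s π‖ ^ 2 / 2) :=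
    (gpX_summable k s hs).neg.add (hq.div_const 2)
  have t2 : Tendsto (fun P : Finset gpR => ‖∑' α, gpf k s α‖ *
      Real.exp (∑ π ∈ P, (-(gpf k s π).re + ‖gpf k s π‖ ^ 2 / 2))) atTop
      (𝓝 (‖∑' α, gpf k s α‖ * Real.exp (∑' π : gpR, (-(gpf k s π).re + ‖gpf k s π‖ ^ 2 / 2)))) :=
    ((Real.continuous_exp.tendsto _).comp hsum.hasSum).const_mul _
  have h3 := le_of_tendsto_of_tendsto' t1 t2 (fun P => by
    rw [norm_mul, norm_prod, Real.exp_sum]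
    gcongr with π hπ
    exact gp_one_sub_norm _)
  refine (gpU_one_le.trans h3).trans ?_
  gcongr
  rw [(gpX_summable k s hs).neg.tsum_add (hq.div_const 2), tsum_neg, tsum_div_const]
  unfold gpX gpD
  gcongr
  exact gpf_sq_le k s hs _

lemma gpX_bdd (k : ℕ) (hk : 1 ≤ k) : ∃ C : ℝ, ∀ᶠ s in 𝓝[>] (1:ℝ), gpX k s ≤ C := by
  obtain ⟨C, hC⟩ := gp_L_bdd k hk
  refine ⟨Real.log C + gpD / 2, ?_⟩
  filter_upwards [hC, self_mem_nhdsWithin] with s hs hs1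
  have h1 := gp_upper k s hs1
  have h2 : 1 ≤ C * Real.exp (-gpX k s + gpD / 2) := h1.trans (by gcongr)
  have hC0 : 0 < C := by
    by_contra h
    push Not at h
    have := Real.exp_pos (-gpX k s + gpD / 2)
    nlinarith
  have h3 := Real.log_le_log one_pos h2
  rw [Real.log_one, Real.log_mul hC0.ne' (Real.exp_pos _).ne', Real.log_exp] at h3
  linarith

lemma gp_exp_two (x : ℝ) (h0 : 0 ≤ x) (h1 : x ≤ 1 / 2) : Real.exp (-2 * x) ≤ 1 - x := by
  have h := Real.add_one_le_exp (2 * x)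
  rw [show -2 * x = -(2 * x) by ring, Real.exp_neg, inv_le_iff_one_le_mul₀ (Real.exp_pos _)]
  nlinarith

lemma gp_prime_norm (π : GaussianInt) (h : Prime π) : 2 ≤ ‖GaussianInt.toComplex π‖ ^ 2 := by
  rw [gp_norm_sq_int]
  have h1 : 0 < π.norm := GaussianInt.norm_pos.2 h.ne_zero
  have h2 : π.norm ≠ 1 := by
    intro h2
    exact h.not_isUnit (Zsqrtd.norm_eq_one_iff.1 (by rw [h2]; rfl))
  have h3 : 2 ≤ π.norm := by omega
  exact_mod_cast h3

lemma gp_lower (s : ℝ) (hs : 1 < s) : ‖∑' α, gpf 0 s α‖ ≤ gpU * Real.exp (2 * gpX 0 s) := by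
  have t1 := (gp_euler 0 s hs).norm
  have hU : ‖(gpU : ℂ)‖ = gpU := by
    rw [Complex.norm_real, Real.norm_of_nonneg (by linarith [gpU_one_le])]
  rw [hU] at t1
  have hsum := (gpX_summable 0 s hs).mul_left (-2)
  have t2 : Tendsto (fun P : Finset gpR => ‖∑' α, gpf 0 s α‖ *
      Real.exp (∑ π ∈ P, (-2 * (gpf 0 s π).re))) atTop
      (𝓝 (‖∑' α, gpf 0 s α‖ * Real.exp (∑' π : gpR, (-2 * (gpf 0 s π).re)))) :=
    ((Real.continuous_exp.tendsto _).comp hsum.hasSum).const_mul _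
  have h3 := le_of_tendsto_of_tendsto' t2 t1 (fun P => by
    rw [norm_mul, norm_prod, Real.exp_sum]
    gcongr with π hπ
    have hp := gp_prime_norm π π.2.1
    have h1 : 1 ≤ ‖GaussianInt.toComplex π‖ := gp_one_le_norm _ (π.2.1 : Prime (π : GaussianInt)).ne_zero
    have e : gpf 0 s π = ((‖GaussianInt.toComplex π‖ ^ (-2 * s) : ℝ) : ℂ) := gpH_k0 _ _
    have hle : ‖GaussianInt.toComplex π‖ ^ (-2 * s) ≤ 1 / 2 := by
      calc _ ≤ ‖GaussianInt.toComplex π‖ ^ (-2 : ℝ) := Real.rpow_le_rpow_of_exponent_le h1 (by linarith)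
        _ = (‖GaussianInt.toComplex π‖ ^ 2)⁻¹ := by
          rw [Real.rpow_neg (norm_nonneg _)]; norm_num
        _ ≤ 2⁻¹ := by gcongr
        _ = 1 / 2 := by norm_num
    rw [e, Complex.ofReal_re]
    refine (gp_exp_two _ (by positivity) hle).trans ?_
    rw [← Complex.ofReal_one, ← Complex.ofReal_sub, Complex.norm_real]
    exact le_abs_self _)
  rw [tsum_mul_left] at h3
  have e : ∑' π : gpR, (gpf 0 s π).re = gpX 0 s := rfl
  rw [e, show -2 * gpX 0 s = -(2 * gpX 0 s) by ring, Real.exp_neg, ← div_eq_mul_inv, div_le_iff₀ (Real.exp_pos _)] at h3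
  exact h3

lemma gp_not_summable : ¬ Summable fun α : GaussianInt => ‖GaussianInt.toComplex α‖ ^ (-2 : ℝ) := by
  intro h
  have hinj : Function.Injective (fun p : ℕ × ℕ => (⟨p.1 + 1, p.2⟩ : GaussianInt)) := by
    rintro ⟨a, b⟩ ⟨c, d⟩ h
    simp only [Zsqrtd.mk.injEq] at h
    ext <;> simp <;> omega
  have h1 := h.comp_injective hinj
  have h2 := h1.prod
  have h3 : Summable (fun a : ℕ => 1 / 2 * (1 / ((a + 1 : ℕ) : ℝ))) := by
    refine Summable.of_nonneg_of_le (fun a => by positivity) (fun a => ?_) h2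
    have h4 : Summable (fun b : ℕ => ((fun α : GaussianInt => ‖GaussianInt.toComplex α‖ ^ (-2 : ℝ)) ∘
      fun p : ℕ × ℕ => (⟨p.1 + 1, p.2⟩ : GaussianInt)) (a, b)) := h1.prod_factor a
    refine le_trans ?_ (h4.sum_le_tsum (Finset.range (a + 1)) (fun b _ => by simp only [Function.comp]; positivity))
    have : ∀ b ∈ Finset.range (a + 1), 1 / (2 * ((a:ℝ) + 1) ^ 2) ≤ ((fun α : GaussianInt => ‖GaussianInt.toComplex α‖ ^ (-2 : ℝ)) ∘
      fun p : ℕ × ℕ => (⟨p.1 + 1, p.2⟩ : GaussianInt)) (a, b) := by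
      intro b hb
      have hb' : (b:ℝ) ≤ (a:ℝ) + 1 := by
        have := Finset.mem_range.1 hb
        exact_mod_cast this.le
      simp only [Function.comp]
      rw [Real.rpow_neg (norm_nonneg _), Real.rpow_two, gp_norm_sq, one_div]
      push_cast
      apply inv_anti₀
      · positivity
      · have : (0:ℝ) ≤ b := by positivity
        nlinarith
    refine le_trans ?_ (Finset.sum_le_sum this)
    rw [Finset.sum_const, Finset.card_range, nsmul_eq_mul]
    push_cast
    apply le_of_eq
    field_simp
  have h5 : Summable (fun a : ℕ => 1 / ((a + 1 : ℕ) : ℝ)) := by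
    simpa using h3.mul_left 2
  exact Real.not_summable_one_div_natCast ((summable_nat_add_iff (f := fun a : ℕ => 1 / (a : ℝ)) 1).1 h5)

lemma gp_L_top (M : ℝ) : ∀ᶠ s in 𝓝[>] (1:ℝ), M < ‖∑' α, gpf 0 s α‖ := by
  obtain ⟨T, hT⟩ : ∃ T : Finset GaussianInt, M < ∑ α ∈ T, ‖GaussianInt.toComplex α‖ ^ (-2 : ℝ) := by
    by_contra hcon
    push Not at hcon
    exact gp_not_summable (summable_of_sum_le (fun α => by positivity) hcon)
  have hc : ContinuousAt (fun s : ℝ => ∑ α ∈ T, ‖GaussianInt.toComplex α‖ ^ (-2 * s)) 1 := by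
    apply tendsto_finsetSum
    intro α _
    have h1 : ContinuousAt (fun t : ℝ => ‖GaussianInt.toComplex α‖ ^ t) (-2 * 1) :=
      Real.continuousAt_const_rpow' (by norm_num)
    have h2 : ContinuousAt (fun s : ℝ => -2 * s) 1 := by fun_prop
    exact ContinuousAt.comp (f := fun s : ℝ => -2 * s) (x := (1:ℝ)) h1 h2
  have hev : ∀ᶠ s in 𝓝[>] (1:ℝ), M < ∑ α ∈ T, ‖GaussianInt.toComplex α‖ ^ (-2 * s) :=
    nhdsWithin_le_nhds (hc.eventually (lt_mem_nhds (by simpa using hT)))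
  filter_upwards [hev, self_mem_nhdsWithin] with s hs hs1
  have hs1 : 1 < s := hs1
  have e : ∑' α, gpf 0 s α = ((∑' α : GaussianInt, ‖GaussianInt.toComplex α‖ ^ (-2 * s) : ℝ) : ℂ) := by
    rw [Complex.ofReal_tsum]
    exact tsum_congr fun α => gpH_k0 _ _
  rw [e, Complex.norm_real]
  have hsum : Summable fun α : GaussianInt => ‖GaussianInt.toComplex α‖ ^ (-2 * s) := by
    have := gp_summable (2 * s) (by linarith)
    simpa [neg_mul] using this
  refine lt_of_lt_of_le hs (le_trans (hsum.sum_le_tsum T (fun α _ => by positivity)) (le_abs_self _))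

lemma gpX_top (K : ℝ) : ∀ᶠ s in 𝓝[>] (1:ℝ), K < gpX 0 s := by
  filter_upwards [gp_L_top (gpU * Real.exp (2 * K)), self_mem_nhdsWithin] with s hs hs1
  have h := hs.trans_le (gp_lower s hs1)
  have hU := gpU_one_le
  have h2 := lt_of_mul_lt_mul_left h (by linarith)
  have := Real.exp_lt_exp.1 h2
  linarith

lemma gp_star_prime (π : GaussianInt) (h : Prime π) : Prime (star π) :=
  (MulEquiv.prime_iff (starRingAut : GaussianInt ≃+* GaussianInt)).2 h

lemma gpf_re (k : ℕ) (s : ℝ) (α : GaussianInt) : (gpf k s α).re =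
    (((GaussianInt.toComplex α / (‖GaussianInt.toComplex α‖ : ℂ)) ^ 4) ^ k).re * ‖GaussianInt.toComplex α‖ ^ (-2 * s) := by
  unfold gpf gpH
  rw [Complex.re_mul_ofReal, pow_mul]

lemma gp_angle (ζ : ℂ) (hζ : ‖ζ‖ = 1) (δ : ℝ) (hδ : 0 < δ) (hδ1 : δ ≤ 1) (N : ℝ) :
    ∃ π : GaussianInt, Prime π ∧ N < ‖GaussianInt.toComplex π‖ ∧
      ‖(GaussianInt.toComplex π / (‖GaussianInt.toComplex π‖ : ℂ)) ^ 4 - ζ‖ < δ := by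
  by_contra hcon
  push Not at hcon
  obtain ⟨m, c0, c, hc0, hc, hT⟩ := gp_trig ζ hζ δ hδ hδ1
  set N' : ℝ := max N 1 with hN'
  set K : ℝ := c0 + ∑ k ∈ Finset.range m, |c k| with hK
  have hK0 : 0 ≤ K := by
    have : 0 ≤ ∑ k ∈ Finset.range m, |c k| := Finset.sum_nonneg fun _ _ => abs_nonneg _
    linarith
  set E : ℝ := ∑' π : gpR, K * N' ^ 3 * ‖GaussianInt.toComplex π‖ ^ (-3 : ℝ) with hE
  have hEs : Summable fun π : gpR => K * N' ^ 3 * ‖GaussianInt.toComplex π‖ ^ (-3 : ℝ) :=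
    ((gp_summable 3 (by norm_num)).subtype gpR).mul_left _
  have hmain : ∀ s : ℝ, 1 < s → c0 * gpX 0 s + ∑ k ∈ Finset.range m, c k * gpX (k + 1) s ≤ E := by
    intro s hs
    have s0 := (gpX_summable 0 s hs).mul_left c0
    have sk : ∀ k ∈ Finset.range m, Summable fun π : gpR => c k * (gpf (k + 1) s π).re :=
      fun k _ => (gpX_summable (k + 1) s hs).mul_left (c k)
    have ss := summable_sum sk
    have e : c0 * gpX 0 s + ∑ k ∈ Finset.range m, c k * gpX (k + 1) s =
        ∑' π : gpR, (c0 * (gpf 0 s π).re + ∑ k ∈ Finset.range m, c k * (gpf (k + 1) s π).re) := by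
      rw [s0.tsum_add ss, Summable.tsum_finsetSum sk, tsum_mul_left]
      simp only [tsum_mul_left]
      rfl
    rw [e]
    refine (s0.add ss).tsum_le_tsum (fun π => ?_) hEs
    have hp : Prime (π : GaussianInt) := π.2.1
    have hn1 := gp_one_le_norm _ hp.ne_zero
    set n : ℝ := ‖GaussianInt.toComplex π‖ with hn
    set z : ℂ := (GaussianInt.toComplex π / (n : ℂ)) ^ 4 with hz
    have hz1 : ‖z‖ = 1 := by
      rw [hz, norm_pow, norm_div, Complex.norm_real, Real.norm_of_nonneg (by linarith), ← hn, div_self (by linarith),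
        one_pow]
    have e2 : c0 * (gpf 0 s π).re + ∑ k ∈ Finset.range m, c k * (gpf (k + 1) s π).re =
        (c0 + ∑ k ∈ Finset.range m, c k * (z ^ (k + 1)).re) * n ^ (-2 * s) := by
      simp only [gpf_re, ← hn, ← hz]
      rw [add_mul, Finset.sum_mul]
      simp [mul_assoc]
    rw [e2]
    have hw0 : 0 ≤ n ^ (-2 * s) := by positivity
    by_cases hN : N < n
    · have h1 := hcon π hp hN
      have h2 := hcon (star (π : GaussianInt)) (gp_star_prime _ hp)
      have hst : GaussianInt.toComplex (star (π : GaussianInt)) = (starRingEnd ℂ) (GaussianInt.toComplex π) :=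
        GaussianInt.toComplex_star _
      rw [hst, Complex.norm_conj] at h2
      have h3 := h2 hN
      have e3 : ((starRingEnd ℂ) (GaussianInt.toComplex π) / (n : ℂ)) ^ 4 = (starRingEnd ℂ) z := by
        rw [hz, map_pow, map_div₀, Complex.conj_ofReal]
      rw [← hn, e3] at h3
      have h4 := hT z hz1 h1 h3
      have : (c0 + ∑ k ∈ Finset.range m, c k * (z ^ (k + 1)).re) * n ^ (-2 * s) ≤ 0 :=
        mul_nonpos_of_nonpos_of_nonneg h4 hw0
      refine this.trans ?_
      positivity
    · push Not at hN
      have hTK : c0 + ∑ k ∈ Finset.range m, c k * (z ^ (k + 1)).re ≤ K := by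
        rw [hK]
        gcongr with k hk
        refine (le_abs_self _).trans ?_
        rw [abs_mul]
        have : |(z ^ (k + 1)).re| ≤ 1 := by
          refine (Complex.abs_re_le_norm _).trans ?_
          rw [norm_pow, hz1, one_pow]
        nlinarith [abs_nonneg (c k)]
      have hw1 : n ^ (-2 * s) ≤ 1 := Real.rpow_le_one_of_one_le_of_nonpos hn1 (by linarith)
      have hnN : n ≤ N' := hN.trans (le_max_left _ _)
      have h5 : 1 ≤ N' ^ 3 * n ^ (-3 : ℝ) := by
        have : n ^ (-3 : ℝ) = (n ^ 3)⁻¹ := by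
          rw [Real.rpow_neg (by linarith)]; norm_num
        rw [this, ← div_eq_mul_inv, le_div_iff₀ (by positivity), one_mul]
        gcongr
      calc _ ≤ K * n ^ (-2 * s) := by gcongr
        _ ≤ K * 1 := by gcongr
        _ ≤ K * (N' ^ 3 * n ^ (-3 : ℝ)) := by gcongr
        _ = _ := by ring
  have hC : ∀ k : ℕ, ∃ C : ℝ, ∀ᶠ s in 𝓝[>] (1:ℝ), gpX (k + 1) s ≤ C := fun k => gpX_bdd (k + 1) (by omega)
  choose C hC using hC
  have hall : ∀ᶠ s in 𝓝[>] (1:ℝ), ∀ k ∈ Finset.range m, gpX (k + 1) s ≤ C k :=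
    (Filter.eventually_all_finset _).2 fun k _ => hC k
  obtain ⟨s, hs1, hs2, hs3⟩ := (hall.and ((gpX_top ((E - ∑ k ∈ Finset.range m, c k * C k) / c0)).and
    (self_mem_nhdsWithin))).exists
  have h1 := hmain s hs3
  have h2 : ∑ k ∈ Finset.range m, c k * C k ≤ ∑ k ∈ Finset.range m, c k * gpX (k + 1) s := by
    apply Finset.sum_le_sum
    intro k hk
    exact mul_le_mul_of_nonpos_left (hs1 k hk) (hc k (Finset.mem_range.1 hk))
  rw [div_lt_iff₀ hc0] at hs2
  linarith

lemma gp_quart (a b : ℂ) (ρ : ℝ) (hρ : 0 < ρ) (h : ‖a ^ 4 - b ^ 4‖ < ρ ^ 4) :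
    ∃ u : GaussianInt, IsUnit u ∧ ‖GaussianInt.toComplex u * a - b‖ < ρ := by
  by_contra hcon
  push Not at hcon
  have h1 := hcon 1 isUnit_one
  have h2 := hcon (-1) isUnit_one.neg
  have hi : IsUnit (⟨0, 1⟩ : GaussianInt) := Zsqrtd.norm_eq_one_iff.1 (by simp [Zsqrtd.norm_def])
  have h3 := hcon ⟨0, 1⟩ hi
  have h4 := hcon (-⟨0, 1⟩) hi.neg
  have ei : GaussianInt.toComplex ⟨0, 1⟩ = Complex.I := by simp [GaussianInt.toComplex_def']
  simp only [map_one, map_neg, ei] at h1 h2 h3 h4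
  have e : a ^ 4 - b ^ 4 = -((1 * a - b) * (-1 * a - b) * ((Complex.I * a - b) * (-Complex.I * a - b))) := by
    have hI : Complex.I ^ 2 = -1 := Complex.I_sq
    linear_combination (-(a ^ 2 * (b ^ 2 - a ^ 2))) * hI
  rw [e, norm_neg, norm_mul, norm_mul, norm_mul] at h
  have : ρ ^ 4 ≤ ‖1 * a - b‖ * ‖-1 * a - b‖ * (‖Complex.I * a - b‖ * ‖-Complex.I * a - b‖) := by
    calc ρ ^ 4 = ρ * ρ * (ρ * ρ) := by ring
      _ ≤ _ := by gcongr
  linarith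

lemma gp_approx (z : ℂ) (hz : z ≠ 0) (ε : ℝ) (hε : 0 < ε) : ∃ π₁ π₂ : GaussianInt, Prime π₁ ∧ Prime π₂ ∧
    ‖GaussianInt.toComplex π₁ / GaussianInt.toComplex π₂ - z‖ < ε := by
  have hzn : 0 < ‖z‖ := norm_pos_iff.2 hz
  set η : ℝ := min 1 (ε / (6 * ‖z‖)) with hη
  have hη0 : 0 < η := lt_min one_pos (by positivity)
  have hη1 : η ≤ 1 := min_le_left _ _
  have hη2 : η * (6 * ‖z‖) ≤ ε := by
    rw [← le_div_iff₀ (by positivity)]; exact min_le_right _ _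
  set ζ : ℂ := z / (‖z‖ : ℂ) with hζ
  have hζ1 : ‖ζ‖ = 1 := by
    rw [hζ, norm_div, Complex.norm_real, norm_norm, div_self hzn.ne']
  have hzc : (‖z‖ : ℂ) ≠ 0 := by exact_mod_cast hzn.ne'
  have hzζ : z = ζ * (‖z‖ : ℂ) := by rw [hζ]; field_simp
  obtain ⟨x0, hx0⟩ := eventually_atTop.1 (gp_inert η hη0)
  obtain ⟨π, hπ, hπN, hπζ⟩ := gp_angle (ζ ^ 4) (by rw [norm_pow, hζ1, one_pow]) (η ^ 4) (by positivity)
    (pow_le_one₀ hη0.le hη1) (‖z‖ * Real.exp x0)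
  obtain ⟨u, hu, huζ⟩ := gp_quart _ _ η hη0 hπζ
  set n : ℝ := ‖GaussianInt.toComplex π‖ with hn
  have hn0 : 0 < n := lt_of_lt_of_le one_pos (gp_one_le_norm π hπ.ne_zero)
  have hnc : (n : ℂ) ≠ 0 := by exact_mod_cast hn0.ne'
  have hx : x0 ≤ Real.log (n / ‖z‖) := by
    rw [Real.le_log_iff_exp_le (by positivity), le_div_iff₀ hzn]
    linarith
  obtain ⟨q, hq, hq4, hqη⟩ := hx0 _ hx
  haveI : Fact q.Prime := ⟨hq⟩
  have hq0 : (0:ℝ) < q := by exact_mod_cast hq.pos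
  refine ⟨u * π, (q : GaussianInt), ((associated_unit_mul_left π u hu).prime_iff).2 hπ, GaussianInt.prime_of_nat_prime_of_mod_four_eq_three q hq4, ?_⟩
  set t : ℝ := Real.log (n / ‖z‖) - Real.log q with ht
  have hr : n / q = ‖z‖ * Real.exp t := by
    rw [ht, Real.exp_sub, Real.exp_log (by positivity), Real.exp_log hq0]
    field_simp
  have hexp : |Real.exp t - 1| ≤ 2 * |t| := Real.abs_exp_sub_one_le (by linarith)
  set a : ℂ := GaussianInt.toComplex u * (GaussianInt.toComplex π / (n : ℂ)) with ha
  have e : GaussianInt.toComplex (u * π) / GaussianInt.toComplex (q : GaussianInt) - z =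
      (a - ζ) * ((‖z‖ * Real.exp t : ℝ) : ℂ) + ζ * ((‖z‖ * (Real.exp t - 1) : ℝ) : ℂ) := by
    have e1 : GaussianInt.toComplex (u * π) / GaussianInt.toComplex (q : GaussianInt) = a * ((n / q : ℝ) : ℂ) := by
      rw [ha, map_mul, map_natCast]
      push_cast
      field_simp
    rw [e1, hr]
    nth_rewrite 2 [hzζ]
    push_cast
    ring
  have hte : |Real.exp t| ≤ 3 := by
    have := abs_le.1 hexp
    rw [abs_of_pos (Real.exp_pos t)]
    linarith
  rw [e]
  calc _ ≤ ‖(a - ζ) * ((‖z‖ * Real.exp t : ℝ) : ℂ)‖ + ‖ζ * ((‖z‖ * (Real.exp t - 1) : ℝ) : ℂ)‖ := norm_add_le _ _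
    _ = ‖a - ζ‖ * (‖z‖ * |Real.exp t|) + 1 * (‖z‖ * |Real.exp t - 1|) := by
      rw [norm_mul, norm_mul, Complex.norm_real, Complex.norm_real, Real.norm_eq_abs, Real.norm_eq_abs, abs_mul, abs_mul,
        abs_norm, hζ1]
    _ ≤ η * (‖z‖ * 3) + 1 * (‖z‖ * (2 * η)) := by
      gcongr
      exact hexp.trans (by linarith)
    _ < ε := by nlinarith

/-- The set of quotients of Gaussian primes is dense in ℂ. -/
theorem quotients_of_gaussian_primes_dense :
    Dense {z : ℂ | ∃ π₁ π₂ : GaussianInt, Prime π₁ ∧ Prime π₂ ∧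
      z = GaussianInt.toComplex π₁ / GaussianInt.toComplex π₂} := by
  rw [Metric.dense_iff]
  intro z ε hε
  by_cases hz : z = 0
  · subst hz
    have hne : (((ε / 2 : ℝ)) : ℂ) ≠ 0 := by
      have : (ε / 2 : ℝ) ≠ 0 := by positivity
      exact_mod_cast this
    obtain ⟨π₁, π₂, h1, h2, h⟩ := gp_approx ((ε / 2 : ℝ) : ℂ) hne (ε / 2) (by positivity)
    refine ⟨_, ?_, π₁, π₂, h1, h2, rfl⟩
    rw [Metric.mem_ball, dist_zero_right]
    have h3 := norm_le_norm_add_norm_sub' (GaussianInt.toComplex π₁ / GaussianInt.toComplex π₂) ((ε / 2 : ℝ) : ℂ)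
    rw [Complex.norm_real, Real.norm_of_nonneg (by positivity)] at h3
    linarith
  · obtain ⟨π₁, π₂, h1, h2, h⟩ := gp_approx z hz ε hε
    refine ⟨_, ?_, π₁, π₂, h1, h2, rfl⟩
    rw [Metric.mem_ball, dist_eq_norm]
    exact h
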